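/- Let G = ⟨s₁,…,s_r⟩ be the free group of rank r and let (T,X,μ,α) be a G-process with H(α) < ∞. Then (T,X,μ,α) is a Markov process if and only if F(T,α) = f(T,α). -/

import Mathlib

open MeasureTheory Filter
open scoped ENNReal symmDiff

namespace Bowen

noncomputable section

/-- The free group of rank `r`. -/
abbrev FG (r : ℕ) := FreeGroup (Fin r)

/-- The generating set element corresponding to `(i, b)`: `sᵢ` if `b = true`,
`sᵢ⁻¹` if `b = false`. -/
def gen {r : ℕ} (s : Fin r × Bool) : FG r :=
  cond s.2 (FreeGroup.of s.1) (FreeGroup.of s.1)⁻¹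

/-- The symmetric generating set `S = {s₁^{±1},…,s_r^{±1}}`. -/
def Sset (r : ℕ) : Set (FG r) := Set.range (gen (r := r))

/-- The ball of radius `n` about the identity in the word metric of `(G,S)`. -/
def ball (r n : ℕ) : Set (FG r) := {g | FreeGroup.norm g ≤ n}

section Partitions

variable {X : Type*} [mX : MeasurableSpace X] {K L : Type*}

/-- Shannon entropy of the countable labeled partition `p` with respect to `μ`
(in `ℝ≥0∞`, so that `H(p) < ∞` is meaningful). -/
def Hpart (μ : Measure X) (p : X → K) : ℝ≥0∞ :=
  ∑' k : K, ENNReal.ofReal (Real.negMulLog ((μ (p ⁻¹' {k})).toReal))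

/-- The atom of the partition `p` containing `x`. -/
def atomOf (p : X → K) (x : X) : Set X := p ⁻¹' {p x}

/-- Conditional Shannon entropy of `p` given the sub-σ-algebra `m`:
`H(p|m) = ∫ -log( μ(A_x | m)(x) ) dμ(x)`. -/
def HpartC (μ : Measure X) (p : X → K) (m : MeasurableSpace X) : ℝ≥0∞ :=
  ∫⁻ x, ENNReal.ofReal
    (- Real.log ((μ[(atomOf p x).indicator (fun _ => (1:ℝ)) | m]) x)) ∂μ

/-- Join of two labeled partitions. -/
def pjoin (p : X → K) (q : X → L) : X → K × L := fun x => (p x, q x)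

/-- Pullback partition `T_g^{-1} p`. -/
def pull {r : ℕ} (T : FG r → X → X) (g : FG r) (p : X → K) : X → K :=
  fun x => p (T g x)

/-- The join `⋁_{q ∈ Q} T_q^{-1} p` over a set `Q ⊆ G`. -/
def powS {r : ℕ} (T : FG r → X → X) (p : X → K) (Q : Set (FG r)) : X → (Q → K) :=
  fun x q => p (T (q : FG r) x)

/-- The join `p^n = ⋁_{g ∈ B(e,n)} T_g^{-1} p`. -/
def pow {r : ℕ} (T : FG r → X → X) (p : X → K) (n : ℕ) : X → (ball r n → K) :=
  powS T p (ball r n)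

/-- The σ-algebra generated by the partition `p`. -/
def sAlg (p : X → K) : MeasurableSpace X := MeasurableSpace.comap p ⊤

/-- The smallest `G`-invariant σ-algebra containing the partition `p`. -/
def sAlgG {r : ℕ} (T : FG r → X → X) (p : X → K) : MeasurableSpace X :=
  ⨆ g : FG r, sAlg (pull T g p)

/-- The σ-algebra `⋁_{f ∈ Q} T_f^{-1} p` for a (possibly infinite) `Q ⊆ G`. -/
def sAlgSet {r : ℕ} (T : FG r → X → X) (p : X → K) (Q : Set (FG r)) :
    MeasurableSpace X :=
  ⨆ f ∈ Q, sAlg (pull T f p)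

/-- `F(T,α) = (1−2r)H(α) + ∑ᵢ H(α ∨ T_{sᵢ}^{-1}α)`. -/
def FF {r : ℕ} (T : FG r → X → X) (μ : Measure X) (p : X → K) : ℝ :=
  (1 - 2 * (r : ℝ)) * (Hpart μ p).toReal
    + ∑ i : Fin r, (Hpart μ (pjoin p (pull T (FreeGroup.of i) p))).toReal

/-- `f(T,α) = inf_{n>0} F(T,α^n)`, as an extended real. -/
def littleF {r : ℕ} (T : FG r → X → X) (μ : Measure X) (p : X → K) : EReal :=
  ⨅ n : ℕ, ((FF T μ (pow T p (n + 1)) : ℝ) : EReal)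

/-- Conditional version `F(T,α|𝓕) = (1−2r)H(α|𝓕) + ∑ᵢ H(α ∨ T_{sᵢ}^{-1}α|𝓕)`. -/
def FFc {r : ℕ} (T : FG r → X → X) (μ : Measure X) (m : MeasurableSpace X)
    (p : X → K) : ℝ :=
  (1 - 2 * (r : ℝ)) * (HpartC (mX := mX) μ p m).toReal
    + ∑ i : Fin r, (HpartC (mX := mX) μ (pjoin p (pull T (FreeGroup.of i) p)) m).toReal

/-- Conditional `f(T,α|𝓕) = inf_{n>0} F(T,α^n|𝓕)`. -/
def littleFc {r : ℕ} (T : FG r → X → X) (μ : Measure X) (m : MeasurableSpace X)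
    (p : X → K) : EReal :=
  ⨅ n : ℕ, ((FFc (mX := mX) T μ m (pow T p (n + 1)) : ℝ) : EReal)

/-- The mean entropy `h(T_s, α) = lim_n H(⋁_{i=0}^n T_s^{-i}α)/(n+1)`; since the
sequence is subadditive the limit equals the infimum, which we take as the
definition. -/
def hrate {r : ℕ} (T : FG r → X → X) (μ : Measure X) (s : FG r) (p : X → K) : ℝ :=
  ⨅ n : ℕ, (Hpart μ (fun x (i : Fin (n + 1)) => p (T (s ^ (i : ℕ)) x))).toReal / (n + 1)

/-- Conditional mean entropy `h(T_s, α|𝓕) = lim_n H(⋁_{i=0}^n T_s^{-i}α | 𝓕)/(n+1)`;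
for an invariant `𝓕` the sequence is subadditive so the limit equals the infimum. -/
def hrateC {r : ℕ} (T : FG r → X → X) (μ : Measure X) (m : MeasurableSpace X)
    (s : FG r) (p : X → K) : ℝ :=
  ⨅ n : ℕ, (HpartC (mX := mX) μ (fun x (i : Fin (n + 1)) => p (T (s ^ (i : ℕ)) x)) m).toReal / (n + 1)

/-- `F_*(T,α) = (1−r)H(α) + ∑ᵢ h(T_{sᵢ},α)`. -/
def Fstar {r : ℕ} (T : FG r → X → X) (μ : Measure X) (p : X → K) : ℝ :=
  (1 - (r : ℝ)) * (Hpart μ p).toReal + ∑ i : Fin r, hrate T μ (FreeGroup.of i) p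

/-- `f_*(T,α) = inf_{n>0} F_*(T,α^n)`. -/
def fstar {r : ℕ} (T : FG r → X → X) (μ : Measure X) (p : X → K) : EReal :=
  ⨅ n : ℕ, ((Fstar T μ (pow T p (n + 1)) : ℝ) : EReal)

/-- `F_*(T,α|𝓕) = (1−r)H(α|𝓕) + ∑ᵢ h(T_{sᵢ},α|𝓕)`. -/
def FstarC {r : ℕ} (T : FG r → X → X) (μ : Measure X) (m : MeasurableSpace X)
    (p : X → K) : ℝ :=
  (1 - (r : ℝ)) * (HpartC (mX := mX) μ p m).toReal + ∑ i : Fin r, hrateC (mX := mX) T μ m (FreeGroup.of i) p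

/-- `f_*(T,α|𝓕) = inf_{n>0} F_*(T,α^n|𝓕)`. -/
def fstarC {r : ℕ} (T : FG r → X → X) (μ : Measure X) (m : MeasurableSpace X)
    (p : X → K) : EReal :=
  ⨅ n : ℕ, ((FstarC (mX := mX) T μ m (pow T p (n + 1)) : ℝ) : EReal)

/-- `p` refines `q`: each atom of `p` is contained, up to a `μ`-null set,
in an atom of `q`. -/
def Refines (μ : Measure X) (p : X → K) (q : X → L) : Prop :=
  ∀ k : K, ∃ l : L, μ (p ⁻¹' {k} \ q ⁻¹' {l}) = 0

/-- Two labeled partitions are equal as partitions (up to null sets). -/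
def PartEquiv (μ : Measure X) (p : X → K) (q : X → L) : Prop :=
  Refines μ p q ∧ Refines μ q p

/-- `σ` is a simple splitting of `p`: `σ = p ∨ T_s^{-1}β` for some `s ∈ S` and
some coarsening `β` of `p`. -/
def SimpleSplit {r : ℕ} (μ : Measure X) (T : FG r → X → X) (p σ : X → ℕ) : Prop :=
  ∃ s ∈ Sset r, ∃ β : X → ℕ, Measurable β ∧ Refines μ p β ∧
    PartEquiv μ σ (pjoin p (pull T s β))

/-- `τ` is a splitting of `p`: obtained from `p` by a finite sequence of simple
splittings (as a partition, i.e. up to relabeling and null sets). -/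
def IsSplitting {r : ℕ} (μ : Measure X) (T : FG r → X → X) (p : X → ℕ)
    (τ : X → K) : Prop :=
  ∃ σ : X → ℕ, Relation.ReflTransGen (SimpleSplit μ T) p σ ∧ PartEquiv μ σ τ

/-- A partition is generating if the smallest `G`-invariant σ-algebra containing it
is the full σ-algebra up to `μ`-null sets. -/
def Generating {r : ℕ} (T : FG r → X → X) (μ : Measure X) (p : X → K) : Prop :=
  ∀ A : Set X, MeasurableSet A →
    ∃ A' : Set X, MeasurableSet[sAlgG T p] A' ∧ μ (A ∆ A') = 0

/-- The Rohlin distance `d(α,β) = H(α|β) + H(β|α)`. -/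
def rohlinDist (μ : Measure X) (p : X → K) (q : X → L) : ℝ :=
  (HpartC μ p (sAlg q)).toReal + (HpartC μ q (sAlg p)).toReal

end Partitions

/-- Adjacency in the left Cayley graph `Γ_L`: an edge joins `a` and `sa`, `s ∈ S`. -/
def adjL {r : ℕ} (a b : FG r) : Prop := ∃ s ∈ Sset r, b = s * a

/-- `Past(g₁;g₂)`: the set of `f ∈ G` such that every path in the left Cayley
graph from `f` to `g₁` passes through `g₂`. -/
def Past {r : ℕ} (g₁ g₂ : FG r) : Set (FG r) :=
  {f | ∀ l : List (FG r), l ≠ [] → l.head? = some f → l.getLast? = some g₁ →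
        l.Chain' adjL → g₂ ∈ l}

/-- A subset `F ⊆ G` is right-connected: the subgraph of the right Cayley graph
induced on `F` is connected. -/
def RightConnected {r : ℕ} (F : Set (FG r)) : Prop :=
  ∀ g ∈ F, ∀ h ∈ F,
    Relation.ReflTransGen (fun a b => a ∈ F ∧ b ∈ F ∧ ∃ s ∈ Sset r, b = a * s) g h

/-- A subset `F ⊆ G` is left-connected: the subgraph of the left Cayley graph
induced on `F` is connected. -/
def LeftConnected {r : ℕ} (F : Set (FG r)) : Prop :=
  ∀ g ∈ F, ∀ h ∈ F,
    Relation.ReflTransGen (fun a b => a ∈ F ∧ b ∈ F ∧ ∃ s ∈ Sset r, b = s * a) g h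

section Markov

variable {X : Type*} [MeasurableSpace X] {K : Type*}

/-- A `G`-process `(T,X,μ,α)` is Markov: for every `s ∈ S`, `g ∈ G` and every atom
`A` of `α`, `μ(T_{sg}^{-1}A | ⋁_{f∈Past(sg;g)} T_f^{-1}α) = μ(T_{sg}^{-1}A | T_g^{-1}α)`
almost everywhere. -/
def IsMarkov {r : ℕ} (μ : Measure X) (T : FG r → X → X) (p : X → K) : Prop :=
  ∀ s ∈ Sset r, ∀ g : FG r, ∀ k : K,
    (μ[((pull T (s * g) p) ⁻¹' {k}).indicator (fun _ => (1:ℝ)) |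
        sAlgSet T p (Past (s * g) g)])
      =ᵐ[μ]
    (μ[((pull T (s * g) p) ⁻¹' {k}).indicator (fun _ => (1:ℝ)) |
        sAlg (pull T g p)])

end Markov


section ExtraDefs

/-- The distance `d₁` between two ordered processes:
`∑_{s∈S} ∑_{i,j} |μ(A_i ∩ T_s^{-1}A_j) − ν(B_i ∩ U_s^{-1}B_j)|`. -/
def d1 {X Y : Type*} [MeasurableSpace X] [MeasurableSpace Y] {r : ℕ}
    (T : FG r → X → X) (μ : Measure X) (α : X → ℕ)
    (U : FG r → Y → Y) (ν : Measure Y) (β : Y → ℕ) : ℝ :=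
  ∑ i : Fin r, ∑ b : Bool,
    ∑' ij : ℕ × ℕ,
      |(μ (α ⁻¹' {ij.1} ∩ pull T (gen (i, b)) α ⁻¹' {ij.2})).toReal -
        (ν (β ⁻¹' {ij.1} ∩ pull U (gen (i, b)) β ⁻¹' {ij.2})).toReal|

/-- Isomorphism of ordered processes: a measure conjugacy between conull sets
intertwining the actions and carrying the `i`-th atom to the `i`-th atom. -/
def OrderedIso {X Y : Type*} [MeasurableSpace X] [MeasurableSpace Y] {r : ℕ}
    (T : FG r → X → X) (μ : Measure X) (α : X → ℕ)
    (U : FG r → Y → Y) (ν : Measure Y) (β : Y → ℕ) : Prop :=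
  ∃ (X' : Set X) (Y' : Set Y) (φ : X → Y) (ψ : Y → X),
    MeasurableSet X' ∧ MeasurableSet Y' ∧ μ X'ᶜ = 0 ∧ ν Y'ᶜ = 0 ∧
    Measurable φ ∧ Measurable ψ ∧ Set.MapsTo φ X' Y' ∧ Set.MapsTo ψ Y' X' ∧
    (∀ x ∈ X', ψ (φ x) = x) ∧ (∀ y ∈ Y', φ (ψ y) = y) ∧
    Measure.map φ μ = ν ∧
    (∀ (g : FG r), ∀ x ∈ X', φ (T g x) = U g (φ x)) ∧
    (∀ x ∈ X', β (φ x) = α x)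

/-- A transition system for `(G,S)`: a family of `K × K` matrices indexed by the
generating set together with a row vector, written as functions. -/
structure TransSys (r : ℕ) (K : Type*) where
  P : Fin r × Bool → K → K → ℝ
  pi : K → ℝ

/-- The transition system is an invariant transition system: the `P^s` are
stochastic matrices, `π` is a probability vector which is a steady state vector
for every `P^s`, and `π_i P^{s^{-1}}_{ij} = π_j P^s_{ji}`. -/
def TransSys.IsInvariant {r : ℕ} {K : Type*} (ts : TransSys r K) : Prop :=
  (∀ s i j, 0 ≤ ts.P s i j) ∧ (∀ s i, HasSum (ts.P s i) 1) ∧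
    (∀ i, 0 ≤ ts.pi i) ∧ HasSum ts.pi 1 ∧
    (∀ s j, HasSum (fun i => ts.pi i * ts.P s i j) (ts.pi j)) ∧
    (∀ s i j, ts.pi i * ts.P (s.1, !s.2) i j = ts.pi j * ts.P s j i)

/-- The canonical (shift) action of `G` on `K^G`: `(T_g x)(f) = x(fg)`. -/
def shiftT {r : ℕ} {K : Type*} : FG r → (FG r → K) → (FG r → K) :=
  fun g x f => x (f * g)

/-- `μ` is (a measure) induced by the transition system `ts`: the time-`e`
distribution is `π` and the transition probabilities into the complement of the
past are given by the matrices `P^s`.  (Note `T_g^{-1}A_k = {x : x(g) = k}`;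
the conditional equalities `μ(A|B) = c` are recorded in the equivalent product
form `μ(A ∩ B) = c·μ(B)`.) -/
def IsInducedBy {r : ℕ} {K : Type*} [MeasurableSpace K]
    (μ : Measure (FG r → K)) (ts : TransSys r K) : Prop :=
  (∀ k : K, μ {x | x 1 = k} = ENNReal.ofReal (ts.pi k)) ∧
  ∀ (s : Fin r × Bool) (g : FG r),
    FreeGroup.norm (gen s * g) = FreeGroup.norm g + 1 →
    ∀ (n : ℕ) (fs : Fin n → FG r) (ks : Fin n → K) (k₀ k : K),
      (∀ i, fs i ∈ Past (gen s * g) g ∧ fs i ≠ g) →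
      (μ ({x | x (gen s * g) = k} ∩ ({x | x g = k₀} ∩ ⋂ i, {x | x (fs i) = ks i}))
          = ENNReal.ofReal (ts.P s k₀ k) * μ ({x | x g = k₀} ∩ ⋂ i, {x | x (fs i) = ks i})) ∧
      μ ({x | x (gen s * g) = k} ∩ {x | x g = k₀})
          = ENNReal.ofReal (ts.P s k₀ k) * μ {x | x g = k₀}

end ExtraDefs

/-! ### Words in the free group -/

lemma gen_eq_mk {r : ℕ} (s : Fin r × Bool) : gen s = FreeGroup.mk [s] := by
  rcases s with ⟨i, b⟩
  cases b
  · simp [gen, FreeGroup.of, FreeGroup.inv_mk, FreeGroup.invRev]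
  · simp [gen, FreeGroup.of]

lemma gen_inv {r : ℕ} (s : Fin r × Bool) : (gen s)⁻¹ = gen (s.1, !s.2) := by
  rw [gen_eq_mk, gen_eq_mk, FreeGroup.inv_mk]; simp [FreeGroup.invRev]

lemma gen_true {r : ℕ} (i : Fin r) : gen (i, true) = FreeGroup.of i := rfl

lemma toWord_mk_of_isReduced {r : ℕ} {L : List (Fin r × Bool)} (h : FreeGroup.IsReduced L) :
    (FreeGroup.mk L).toWord = L := by
  rw [FreeGroup.toWord_mk, h.reduce_eq]

lemma toWord_gen {r : ℕ} (s : Fin r × Bool) : (gen s).toWord = [s] := by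
  rw [gen_eq_mk]; exact toWord_mk_of_isReduced FreeGroup.IsReduced.singleton

lemma eq_mk_of_toWord {r : ℕ} {h : FG r} {L : List (Fin r × Bool)} (hL : h.toWord = L) :
    h = FreeGroup.mk L := by rw [← hL, FreeGroup.mk_toWord]

lemma isReduced_of_toWord {r : ℕ} {h : FG r} {L : List (Fin r × Bool)} (hL : h.toWord = L) :
    FreeGroup.IsReduced L := by rw [← hL]; exact FreeGroup.isReduced_toWord

lemma mul_inv_last {r : ℕ} {h : FG r} {L : List (Fin r × Bool)} {s : Fin r × Bool}
    (hL : h.toWord = L ++ [s]) : (h * (gen s)⁻¹).toWord = L := by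
  have h1 : h * (gen s)⁻¹ = FreeGroup.mk L := by
    rw [mul_inv_eq_iff_eq_mul, gen_eq_mk, FreeGroup.mul_mk]; exact eq_mk_of_toWord hL
  rw [h1]
  exact toWord_mk_of_isReduced (List.IsChain.left_of_append (isReduced_of_toWord hL))

lemma mul_inv_other {r : ℕ} {h : FG r} {L : List (Fin r × Bool)} {s u : Fin r × Bool}
    (hL : h.toWord = L ++ [s]) (hu : u ≠ s) :
    (h * (gen u)⁻¹).toWord = L ++ [s] ++ [(u.1, !u.2)] := by
  rw [eq_mk_of_toWord hL, gen_inv, gen_eq_mk, FreeGroup.mul_mk]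
  apply toWord_mk_of_isReduced
  have := (isReduced_of_toWord hL)
  have h2 : FreeGroup.IsReduced ([s] ++ [(u.1, !u.2)]) := by
    simp only [FreeGroup.IsReduced, List.cons_append, List.nil_append, List.isChain_cons_cons,
      List.isChain_singleton, and_true]
    intro h1
    by_contra hc
    apply hu
    ext
    · exact congrArg Fin.val h1.symm
    · cases h3 : u.2 <;> cases h4 : s.2 <;> simp_all
  exact FreeGroup.IsReduced.append_overlap this h2 (by simp)

lemma mul_left_tail {r : ℕ} {g : FG r} {L : List (Fin r × Bool)} {t : Fin r × Bool}
    (hL : g.toWord = t :: L) : (FreeGroup.mk L).toWord = L ∧ g = gen t * FreeGroup.mk L := by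
  constructor
  · exact toWord_mk_of_isReduced (List.IsChain.tail (isReduced_of_toWord hL))
  · rw [gen_eq_mk, FreeGroup.mul_mk]; exact eq_mk_of_toWord hL

/-- left multiplication by a generator either conses or strips the first letter -/
lemma mul_left_cases {r : ℕ} (t : Fin r × Bool) (g : FG r) :
    (gen t * g).toWord = t :: g.toWord ∨ g.toWord = (t.1, !t.2) :: (gen t * g).toWord := by
  have h1 : gen t * g = FreeGroup.mk (t :: g.toWord) := by
    conv_lhs => rw [gen_eq_mk, ← FreeGroup.mk_toWord (x := g), FreeGroup.mul_mk]
    rfl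
  by_cases hr : FreeGroup.IsReduced (t :: g.toWord)
  · left; rw [h1]; exact toWord_mk_of_isReduced hr
  · right
    cases hg : g.toWord with
    | nil => rw [hg] at hr; exact absurd FreeGroup.IsReduced.singleton hr
    | cons a L =>
      have hL := isReduced_of_toWord hg
      rw [hg] at hr
      have : a = (t.1, !t.2) := by
        by_contra hc
        apply hr
        simp only [FreeGroup.IsReduced, List.isChain_cons_cons]
        refine ⟨fun h => ?_, hL⟩
        by_contra h3
        apply hc
        ext
        · exact congrArg Fin.val h.symm
        · cases h4 : t.2 <;> cases h5 : a.2 <;> simp_all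
      subst this
      obtain ⟨h2, h3⟩ := mul_left_tail hg
      have : gen t * g = FreeGroup.mk L := by
        rw [h3, ← gen_inv, mul_inv_cancel_left]
      rw [this, h2]

/-! ### Balls -/

lemma ball_finite (r n : ℕ) : (ball r n).Finite := by
  have h := List.finite_length_le (Fin r × Bool) n
  exact Set.Finite.of_injOn (f := FreeGroup.toWord) (t := {l | l.length ≤ n})
    (fun g hg => hg) (FreeGroup.toWord_injective.injOn) h

def ballF (r n : ℕ) : Finset (FG r) := (ball_finite r n).toFinset

lemma mem_ballF {r n : ℕ} {g : FG r} : g ∈ ballF r n ↔ g.toWord.length ≤ n := by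
  simp [ballF, ball, FreeGroup.norm]

lemma ballF_zero {r : ℕ} : ballF r 0 = {1} := by
  ext g; simp [mem_ballF]

lemma ballF_mono {r n : ℕ} : ballF r n ⊆ ballF r (n+1) := by
  intro g; simp only [mem_ballF]; omega

/-! ### Set functions -/

/-- right translate -/
def tr {r : ℕ} (A : Finset (FG r)) (g : FG r) : Finset (FG r) := A.image (· * g)

lemma mem_tr {r : ℕ} {A : Finset (FG r)} {g x : FG r} : x ∈ tr A g ↔ x * g⁻¹ ∈ A := by
  simp only [tr, Finset.mem_image]
  constructor
  · rintro ⟨a, ha, rfl⟩; simpa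
  · intro h; exact ⟨_, h, by simp⟩

lemma tr_tr {r : ℕ} (A : Finset (FG r)) (g k : FG r) : tr (tr A g) k = tr A (g * k) := by
  ext x; simp [mem_tr, mul_assoc]

lemma tr_union {r : ℕ} (A B : Finset (FG r)) (g : FG r) : tr (A ∪ B) g = tr A g ∪ tr B g := by
  ext x; simp [mem_tr]

lemma tr_insert {r : ℕ} (A : Finset (FG r)) (x g : FG r) :
    tr (insert x A) g = insert (x * g) (tr A g) := by
  ext y; simp [mem_tr, mul_inv_eq_iff_eq_mul]

lemma tr_one {r : ℕ} (A : Finset (FG r)) : tr A 1 = A := by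
  ext x; simp [mem_tr]

/-- conditional increment -/
def dd {r : ℕ} (hh : Finset (FG r) → ℝ) (x : FG r) (A : Finset (FG r)) : ℝ :=
  hh (insert x A) - hh A

def FQ {r : ℕ} (hh : Finset (FG r) → ℝ) (A : Finset (FG r)) : ℝ :=
  (1 - 2 * (r : ℝ)) * hh A + ∑ i : Fin r, hh (A ∪ tr A (FreeGroup.of i))

/-- right-invariant submodular set function -/
structure Adm {r : ℕ} (hh : Finset (FG r) → ℝ) : Prop where
  inv : ∀ A g, hh (tr A g) = hh A
  anti : ∀ x A B, A.Nonempty → A ⊆ B → dd hh x B ≤ dd hh x A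

section Comb
variable {r : ℕ} {hh : Finset (FG r) → ℝ}

lemma dd_mem {x : FG r} {A : Finset (FG r)} (h : x ∈ A) : dd hh x A = 0 := by
  simp [dd, Finset.insert_eq_of_mem h]

lemma dd_tr (H : Adm hh) (x : FG r) (A : Finset (FG r)) (g : FG r) :
    dd hh (x * g) (tr A g) = dd hh x A := by
  simp only [dd, ← tr_insert, H.inv]

lemma flip (H : Adm hh) (A : Finset (FG r)) (g : FG r) :
    hh (A ∪ tr A g⁻¹) = hh (A ∪ tr A g) := by
  rw [← H.inv (A ∪ tr A g⁻¹) g, tr_union, tr_tr, inv_mul_cancel, tr_one, Finset.union_comm]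

lemma flip_gen (H : Adm hh) (A : Finset (FG r)) (u : Fin r × Bool) :
    hh (A ∪ tr A (FreeGroup.of u.1)) = hh (A ∪ tr A (gen u)) := by
  rcases u with ⟨i, b⟩
  cases b
  · exact (flip H A (FreeGroup.of i)).symm
  · rfl

lemma V_formula (H : Adm hh) (Q : Finset (FG r)) (h : FG r) (u : Fin r × Bool) :
    hh (insert h Q ∪ tr (insert h Q) (FreeGroup.of u.1)) - hh (Q ∪ tr Q (FreeGroup.of u.1))
    = dd hh h (Q ∪ tr (insert h Q) (gen u)) + dd hh h (Q ∪ tr Q (gen u)⁻¹) := by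
  rw [flip_gen H, flip_gen H, ← dd_tr H h (Q ∪ tr Q (gen u)⁻¹) (gen u), tr_union, tr_tr,
    inv_mul_cancel, tr_one, Finset.union_comm (tr Q (gen u)) Q]
  simp only [dd, tr_insert, Finset.insert_union, Finset.union_insert]
  rw [Finset.insert_comm (h * gen u) h]
  ring

lemma sum_k (i0 : Fin r) : ∑ i : Fin r, (if i = i0 then (1:ℝ) else 2) = 2 * r - 1 := by
  have : ∀ i : Fin r, (if i = i0 then (1:ℝ) else 2) = 2 - if i = i0 then 1 else 0 := by
    intro i; split_ifs <;> norm_num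
  simp only [this, Finset.sum_sub_distrib]
  simp; ring

lemma FQ_diff (Q : Finset (FG r)) (h : FG r) (i0 : Fin r) :
    FQ hh (insert h Q) - FQ hh Q =
    ∑ i : Fin r, ((hh (insert h Q ∪ tr (insert h Q) (FreeGroup.of i))
        - hh (Q ∪ tr Q (FreeGroup.of i))) - (if i = i0 then (1:ℝ) else 2) * dd hh h Q) := by
  rw [Finset.sum_sub_distrib, ← Finset.sum_mul, sum_k, Finset.sum_sub_distrib]
  simp only [FQ, dd]; ring

/-- second term in `V_formula` -/
lemma second_le (H : Adm hh) {n : ℕ} {Q : Finset (FG r)} {h : FG r} {L : List (Fin r × Bool)}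
    {s u : Fin r × Bool} (hQ1 : ballF r n ⊆ Q) (hw : h.toWord = L ++ [s]) (hn : L.length = n)
    (hu : u ≠ s) :
    dd hh h (Q ∪ tr Q (gen u)⁻¹) ≤ ((if u.1 = s.1 then (1:ℝ) else 2) - 1) * dd hh h Q := by
  have hQ : Q.Nonempty := ⟨1, hQ1 (by simp [mem_ballF])⟩
  split_ifs with hc
  · have : (gen u)⁻¹ = gen s := by
      rw [gen_inv]; congr 1; ext
      · simp [hc]
      · have : u.2 ≠ s.2 := fun h => hu (Prod.ext hc h)
        cases h1 : u.2 <;> cases h2 : s.2 <;> simp_all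
    rw [this, dd_mem]
    · simp
    · apply Finset.mem_union_right
      rw [mem_tr]; apply hQ1; rw [mem_ballF, mul_inv_last hw, hn]
  · have := H.anti h Q (Q ∪ tr Q (gen u)⁻¹) hQ Finset.subset_union_left
    linarith

def opp (s : Fin r × Bool) (i : Fin r) : Fin r × Bool := (i, if i = s.1 then !s.2 else true)

lemma opp_ne (s : Fin r × Bool) (i : Fin r) : opp s i ≠ s := by
  intro h
  have h1 : i = s.1 := congrArg Prod.fst h
  have h2 := congrArg Prod.snd h
  simp [opp, h1] at h2

lemma V_le (H : Adm hh) {n : ℕ} {Q : Finset (FG r)} {h : FG r} {L : List (Fin r × Bool)}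
    {s : Fin r × Bool} (hQ1 : ballF r n ⊆ Q) (hw : h.toWord = L ++ [s]) (hn : L.length = n)
    (i : Fin r) :
    (hh (insert h Q ∪ tr (insert h Q) (FreeGroup.of i))
        - hh (Q ∪ tr Q (FreeGroup.of i))) - (if i = s.1 then (1:ℝ) else 2) * dd hh h Q ≤ 0 := by
  have hQ : Q.Nonempty := ⟨1, hQ1 (by simp [mem_ballF])⟩
  have h1 := V_formula H Q h (opp s i)
  have h2 := second_le H hQ1 hw hn (opp_ne s i)
  have h3 := H.anti h Q (Q ∪ tr (insert h Q) (gen (opp s i))) hQ Finset.subset_union_left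
  simp only [show (opp s i).1 = i from rfl] at h1 h2
  rw [h1]; linarith

lemma step_le (H : Adm hh) {n : ℕ} {Q : Finset (FG r)} {h : FG r} {L : List (Fin r × Bool)}
    {s : Fin r × Bool} (hQ1 : ballF r n ⊆ Q) (hw : h.toWord = L ++ [s]) (hn : L.length = n) :
    FQ hh (insert h Q) ≤ FQ hh Q := by
  have := FQ_diff (hh := hh) Q h s.1
  have h2 := Finset.sum_nonpos (fun i (_ : i ∈ Finset.univ) => V_le H hQ1 hw hn i)
  linarith

lemma step_eq (H : Adm hh) {n : ℕ} {Q : Finset (FG r)} {h : FG r} {L : List (Fin r × Bool)}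
    {s : Fin r × Bool} (hQ1 : ballF r n ⊆ Q) (hw : h.toWord = L ++ [s]) (hn : L.length = n)
    (he : FQ hh (insert h Q) = FQ hh Q) (u : Fin r × Bool) (hu : u ≠ s) :
    dd hh h (Q ∪ tr (insert h Q) (gen u)) = dd hh h Q := by
  have hQ : Q.Nonempty := ⟨1, hQ1 (by simp [mem_ballF])⟩
  have h0 := FQ_diff (hh := hh) Q h s.1
  rw [he, sub_self] at h0
  have h4 := (Finset.sum_eq_zero_iff_of_nonpos
    (fun i (_ : i ∈ Finset.univ) => V_le H hQ1 hw hn i)).1 h0.symm u.1 (Finset.mem_univ _)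
  have h1 := V_formula H Q h u
  have h2 := second_le H hQ1 hw hn hu
  have h3 := H.anti h Q (Q ∪ tr (insert h Q) (gen u)) hQ Finset.subset_union_left
  rw [h1] at h4
  linarith

/-- monotone chain principle -/
lemma chain_rel (R : ℝ → ℝ → Prop) (hrefl : ∀ x, R x x) (htr : ∀ x y z, R x y → R y z → R x z)
    {n : ℕ}
    (hstep : ∀ (Q : Finset (FG r)) (h : FG r) (L : List (Fin r × Bool)) (s : Fin r × Bool),
      ballF r n ⊆ Q → Q ⊆ ballF r (n+1) → h ∉ Q → h.toWord = L ++ [s] → L.length = n →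
      R (FQ hh (insert h Q)) (FQ hh Q))
    {Q E : Finset (FG r)} (hQ : ballF r n ⊆ Q) (hQE : Q ⊆ E) (hE : E ⊆ ballF r (n+1)) :
    R (FQ hh E) (FQ hh Q) := by
  obtain ⟨D, rfl⟩ : ∃ D, E = Q ∪ D := ⟨E, (Finset.union_eq_right.2 hQE).symm⟩
  clear hQE
  induction D using Finset.induction_on with
  | empty => simpa using hrefl _
  | insert h D hD ih =>
    have ih := ih ((Finset.union_subset_union_right (Finset.subset_insert _ _)).trans hE)
    rw [Finset.union_insert]
    by_cases hm : h ∈ Q ∪ D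
    · rwa [Finset.insert_eq_of_mem hm]
    refine htr _ _ _ ?_ ih
    have h1 : h.toWord.length ≤ n + 1 := mem_ballF.1 (hE (by simp))
    have h2 : ¬ h.toWord.length ≤ n := fun hc => hm (Finset.mem_union_left _ (hQ (mem_ballF.2 hc)))
    obtain hnil | ⟨L, s, hw⟩ := List.eq_nil_or_concat h.toWord
    · simp [hnil] at h2
    · rw [List.concat_eq_append] at hw
      rw [hw] at h1 h2
      simp at h1 h2
      exact hstep _ h L s (hQ.trans Finset.subset_union_left)
        ((Finset.union_subset_union_right (Finset.subset_insert _ _)).trans hE) hm hw (by omega)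

lemma FQ_mono (H : Adm hh) {n : ℕ} {Q E : Finset (FG r)} (hQ : ballF r n ⊆ Q) (hQE : Q ⊆ E)
    (hE : E ⊆ ballF r (n+1)) : FQ hh E ≤ FQ hh Q :=
  chain_rel (hh := hh) (· ≤ ·) le_refl (fun _ _ _ => le_trans)
    (fun _ _ _ _ h1 _ _ h4 h5 => step_le H h1 h4 h5) hQ hQE hE

lemma FQ_ball_succ (H : Adm hh) (n : ℕ) : FQ hh (ballF r (n+1)) ≤ FQ hh (ballF r n) :=
  FQ_mono H (Finset.Subset.refl _) ballF_mono (Finset.Subset.refl _)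

theorem FQ_ball_le (H : Adm hh) (n : ℕ) : FQ hh (ballF r n) ≤ FQ hh (ballF r 0) := by
  induction n with
  | zero => exact le_rfl
  | succ n ih => exact (FQ_ball_succ H n).trans ih

/-! Markov implies equality -/
theorem comb_forward (H : Adm hh)
    (hM : ∀ (t : Fin r × Bool) (L : List (Fin r × Bool)) (h : FG r) (A : Finset (FG r)),
      h.toWord = t :: L → FreeGroup.mk L ∈ A → (∀ f ∈ A, ¬ h.toWord <:+ f.toWord) →
      dd hh h A = dd hh h {FreeGroup.mk L}) (n : ℕ) :
    FQ hh (ballF r n) = FQ hh (ballF r 0) := by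
  induction n with
  | zero => rfl
  | succ n ih =>
    rw [← ih]
    refine chain_rel (hh := hh) (· = ·) (fun _ => rfl) (fun _ _ _ => Eq.trans) ?_
      (Finset.Subset.refl _) ballF_mono (Finset.Subset.refl _)
    intro Q h L s hQ1 hQ2 hh' hw hn
    obtain ⟨t, L', hw'⟩ : ∃ t L', h.toWord = t :: L' := by
      cases hc : h.toWord with
      | nil => simp [hc] at hw
      | cons t L' => exact ⟨t, L', rfl⟩
    have hlen : L'.length = n := by
      have := congrArg List.length (hw.symm.trans hw'); simp at this; omega
    have hq : FreeGroup.mk L' ∈ Q := hQ1 (by rw [mem_ballF, (mul_left_tail hw').1, hlen])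
    have hQs : ∀ f ∈ Q, ¬ h.toWord <:+ f.toWord := by
      intro f hf hs
      have h1 := mem_ballF.1 (hQ2 hf)
      have h2 := hs.eq_of_length_le (by rw [hw]; simpa [hn] using h1)
      exact hh' (by rwa [FreeGroup.toWord_injective h2])
    have hQu : ∀ u, u ≠ s → ∀ f ∈ tr (insert h Q) (gen u), ¬ h.toWord <:+ f.toWord := by
      intro u hu f hf hs
      rw [mem_tr] at hf
      have h1 : f * (gen u)⁻¹ ∈ ballF r (n+1) := by
        rw [Finset.mem_insert] at hf
        rcases hf with hf | hf
        · rw [hf, mem_ballF, hw]; simp [hn]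
        · exact hQ2 hf
      obtain ⟨Y, hY⟩ := hs
      have h2 : f.toWord = (Y ++ L) ++ [s] := by rw [← hY, hw]; simp
      rw [mem_ballF, mul_inv_other h2 hu] at h1
      simp at h1; omega
    have e1 : dd hh h Q = dd hh h {FreeGroup.mk L'} := hM t L' h Q hw' hq hQs
    have e2 : ∀ u, u ≠ s → dd hh h (Q ∪ tr (insert h Q) (gen u)) = dd hh h Q := by
      intro u hu
      rw [e1]
      refine hM t L' h _ hw' (Finset.mem_union_left _ hq) ?_
      intro f hf
      rcases Finset.mem_union.1 hf with hf | hf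
      · exact hQs f hf
      · exact hQu u hu f hf
    have e3 : ∀ u, u ≠ s → dd hh h (Q ∪ tr Q (gen u)) = dd hh h Q := by
      intro u hu
      rw [e1]
      refine hM t L' h _ hw' (Finset.mem_union_left _ hq) ?_
      intro f hf
      rcases Finset.mem_union.1 hf with hf | hf
      · exact hQs f hf
      · refine hQu u hu f ?_
        rw [mem_tr] at hf ⊢
        exact Finset.mem_insert_of_mem hf
    rw [← sub_eq_zero, FQ_diff Q h s.1]
    refine Finset.sum_eq_zero fun i _ => ?_
    have h1 := V_formula H Q h (opp s i)
    simp only [show (opp s i).1 = i from rfl] at h1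
    rw [h1, e2 _ (opp_ne s i), gen_inv]
    by_cases hi : i = s.1
    · have : ((opp s i).1, !(opp s i).2) = s := by simp [opp, hi]
      have hz : dd hh h (Q ∪ tr Q (gen s)) = 0 := dd_mem (Finset.mem_union_right _ (by
        rw [mem_tr]; apply hQ1; rw [mem_ballF, mul_inv_last hw, hn]))
      rw [this, hz]; simp [hi]
    · rw [e3]
      · simp [hi]; ring
      · intro hc; exact hi (congrArg Prod.fst hc)

/-! Equality implies Markov -/

def cost (hh : Finset (FG r) → ℝ) (g : FG r) : ℝ :=
  match g.toWord with
  | [] => 0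
  | t :: _ => dd hh (gen t) {1}

lemma cost_cons {g : FG r} {t : Fin r × Bool} {L : List (Fin r × Bool)} (h : g.toWord = t :: L) :
    cost hh g = dd hh (gen t) {1} := by simp [cost, h]

lemma dd_le_cost (H : Adm hh) {g : FG r} {t : Fin r × Bool} {L : List (Fin r × Bool)}
    (h : g.toWord = t :: L) {A : Finset (FG r)} (hA : FreeGroup.mk L ∈ A) :
    dd hh g A ≤ cost hh g := by
  rw [cost_cons h, ← dd_tr H (gen t) {1} (FreeGroup.mk L), ← (mul_left_tail h).2]
  apply H.anti
  · simp [tr]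
  · simpa [tr] using hA

def SufClosed (E : Finset (FG r)) : Prop :=
  ∀ g ∈ E, ∀ t L, g.toWord = t :: L → FreeGroup.mk L ∈ E

lemma upper (H : Adm hh) (D : Finset (FG r)) (hD : SufClosed D) (h1 : (1 : FG r) ∈ D) :
    ∀ (k : ℕ) (E : Finset (FG r)), (E \ D).card = k → D ⊆ E → SufClosed E →
      hh E ≤ hh D + ∑ g ∈ E \ D, cost hh g := by
  intro k
  induction k with
  | zero =>
    intro E hk hDE hE
    have h2 : E \ D = ∅ := Finset.card_eq_zero.1 hk
    have : E = D := Finset.Subset.antisymm (Finset.sdiff_eq_empty_iff_subset.1 h2) hDE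
    subst this; simp
  | succ k ih =>
    intro E hk hDE hE
    have hne : (E \ D).Nonempty := by rw [← Finset.card_pos]; omega
    obtain ⟨g, hg, hmax⟩ := Finset.exists_max_image (E \ D) (fun g => g.toWord.length) hne
    have hgE := (Finset.mem_sdiff.1 hg).1
    have hgD := (Finset.mem_sdiff.1 hg).2
    have hsd : (E.erase g) \ D = (E \ D).erase g := by
      ext x; simp only [Finset.mem_sdiff, Finset.mem_erase]; tauto
    have h3 := ih (E.erase g) (by rw [hsd, Finset.card_erase_of_mem hg, hk]; rfl)
      (fun x hx => Finset.mem_erase.2 ⟨fun hc => hgD (hc ▸ hx), hDE hx⟩) ?_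
    · rw [hsd] at h3
      rw [← Finset.add_sum_erase _ _ hg]
      cases hw : g.toWord with
      | nil => exact absurd (FreeGroup.toWord_eq_nil_iff.1 hw ▸ h1) hgD
      | cons t L =>
        have h4 : dd hh g (E.erase g) ≤ cost hh g := by
          refine dd_le_cost H hw (Finset.mem_erase.2 ⟨?_, hE g hgE t L hw⟩)
          intro hc
          have := congrArg (fun z => z.toWord.length) hc
          simp only [(mul_left_tail hw).1] at this
          rw [hw] at this; simp at this
        rw [dd, Finset.insert_erase hgE] at h4
        linarith
    · intro x hx t L hw
      have hx' := Finset.mem_erase.1 hx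
      refine Finset.mem_erase.2 ⟨?_, hE x hx'.2 t L hw⟩
      intro hc
      by_cases hxD : x ∈ D
      · exact hgD (hc ▸ hD x hxD t L hw)
      · have := hmax x (Finset.mem_sdiff.2 ⟨hx'.2, hxD⟩)
        rw [hw, ← hc, (mul_left_tail hw).1] at this
        simp at this

lemma leaf_cost (H : Adm hh) (he : ∀ n, FQ hh (ballF r n) = FQ hh (ballF r 0)) (n : ℕ) :
    ∀ h : FG r, h.toWord.length = n + 1 → dd hh h ((ballF r (n+1)).erase h) = cost hh h := by
  -- every step is an equality
  have hstep : ∀ (n : ℕ) (Q : Finset (FG r)) (h : FG r), ballF r n ⊆ Q → Q ⊆ ballF r (n+1) →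
      h ∈ ballF r (n+1) → FQ hh (insert h Q) = FQ hh Q := by
    intro n Q h h1 h2 h3
    have h4 : insert h Q ⊆ ballF r (n+1) := Finset.insert_subset h3 h2
    have a1 := FQ_mono H h1 (Finset.subset_insert h Q) h4
    have a2 := FQ_mono H (Finset.Subset.refl _) h1 h2
    have a3 := FQ_mono H (h1.trans (Finset.subset_insert h Q)) h4 (Finset.Subset.refl _)
    have a4 := he n
    have a5 := he (n+1)
    linarith
  -- growing the conditioning set
  have grow : ∀ (n : ℕ) (h : FG r) (L : List (Fin r × Bool)) (s : Fin r × Bool)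
      (Q : Finset (FG r)), h.toWord = L ++ [s] → L.length = n → ballF r n ⊆ Q →
      Q ⊆ ballF r (n+1) → h ∉ Q → (tr (ballF r n) (gen s)).erase h ⊆ Q →
      dd hh h ((ballF r (n+1)).erase h) = dd hh h Q := by
    intro n h L s Q hw hn hQ1 hQ2 hhQ hQ3
    have hne : Q.Nonempty := ⟨1, hQ1 (by simp [mem_ballF])⟩
    have key : ∀ U : Finset (Fin r × Bool), s ∉ U →
        dd hh h (Q ∪ U.biUnion fun u => tr (ballF r n) (gen u)) = dd hh h Q := by
      intro U
      induction U using Finset.induction_on with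
      | empty => intro _; simp
      | insert u U hu ih =>
        intro hs
        rw [Finset.mem_insert, not_or] at hs
        have ih := ih hs.2
        set R := Q ∪ U.biUnion fun u => tr (ballF r n) (gen u) with hR
        have hballtr : ∀ u, tr (ballF r n) (gen u) ⊆ ballF r (n+1) := by
          intro u x hx
          rw [mem_tr, mem_ballF] at hx
          rw [mem_ballF]
          have := FreeGroup.norm_mul_le (x * (gen u)⁻¹) (gen u)
          simp only [FreeGroup.norm, inv_mul_cancel_right, toWord_gen] at this
          simp at this; omega
        have hR1 : ballF r n ⊆ R := hQ1.trans Finset.subset_union_left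
        have hR2 : R ⊆ ballF r (n+1) := by
          apply Finset.union_subset hQ2
          intro x hx
          obtain ⟨u, -, hx⟩ := Finset.mem_biUnion.1 hx
          exact hballtr u hx
        have hhb : h ∈ ballF r (n+1) := by rw [mem_ballF, hw]; simp [hn]
        have h1 := step_eq H hR1 hw hn (hstep n R h hR1 hR2 hhb) u (fun hc => hs.1 hc.symm)
        have hsub1 : Q ∪ (insert u U).biUnion (fun u => tr (ballF r n) (gen u)) ⊆
            R ∪ tr (insert h R) (gen u) := by
          intro x hx
          rw [Finset.biUnion_insert] at hx
          simp only [Finset.mem_union] at hx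
          rcases hx with hx | hx | hx
          · exact Finset.mem_union_left _ (Finset.mem_union_left _ hx)
          · apply Finset.mem_union_right
            rw [mem_tr] at hx ⊢
            exact Finset.mem_insert_of_mem (hR1 hx)
          · exact Finset.mem_union_left _ (Finset.mem_union_right _ hx)
        have h2 := H.anti h _ _ (hne.mono (Finset.subset_union_left)) hsub1
        have h3 := H.anti h Q (Q ∪ (insert u U).biUnion fun u => tr (ballF r n) (gen u)) hne
          Finset.subset_union_left
        linarith
    have h1 := key (Finset.univ.erase s) (by simp)
    have h2 := H.anti h Q ((ballF r (n+1)).erase h) hne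
      (fun x hx => Finset.mem_erase.2 ⟨fun hc => hhQ (hc ▸ hx), hQ2 hx⟩)
    have h3 := H.anti h ((ballF r (n+1)).erase h)
      (Q ∪ (Finset.univ.erase s).biUnion fun u => tr (ballF r n) (gen u)) ?_ ?_
    · linarith
    · refine ⟨1, Finset.mem_erase.2 ⟨?_, by simp [mem_ballF]⟩⟩
      intro hc; rw [← hc] at hw; simp at hw
    · intro x hx
      obtain ⟨hxh, hx⟩ := Finset.mem_erase.1 hx
      rw [mem_ballF] at hx
      obtain hnil | ⟨L', s', hw'⟩ := List.eq_nil_or_concat x.toWord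
      · apply Finset.mem_union_left; apply hQ1; simp [mem_ballF, hnil]
      · rw [List.concat_eq_append] at hw'
        rw [hw'] at hx
        have hx' : x ∈ tr (ballF r n) (gen s') := by
          rw [mem_tr, mem_ballF, mul_inv_last hw']; simpa using hx
        by_cases hss : s' = s
        · subst hss
          exact Finset.mem_union_left _ (hQ3 (Finset.mem_erase.2 ⟨hxh, hx'⟩))
        · apply Finset.mem_union_right
          exact Finset.mem_biUnion.2 ⟨s', by simp [hss], hx'⟩
  induction n with
  | zero =>
    intro h hlen
    obtain ⟨t, hw⟩ := List.length_eq_one_iff.1 hlen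
    have hgt : h = gen t := FreeGroup.toWord_injective (by rw [hw, toWord_gen])
    rw [cost_cons hw, grow 0 h [] t {1} hw rfl (by rw [ballF_zero]) ?_ ?_ ?_, hgt]
    · rw [← ballF_zero]; exact ballF_mono
    · simp only [Finset.mem_singleton]
      intro hc; rw [hc] at hw; simp at hw
    · intro x hx
      rw [ballF_zero] at hx
      simp [tr, hgt] at hx
  | succ n ih =>
    intro h hlen
    obtain hnil | ⟨L, s, hw⟩ := List.eq_nil_or_concat h.toWord
    · simp [hnil] at hlen
    rw [List.concat_eq_append] at hw
    have hn : L.length = n + 1 := by rw [hw] at hlen; simpa using hlen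
    have hw0 : (h * (gen s)⁻¹).toWord = L := mul_inv_last hw
    set h0 := h * (gen s)⁻¹ with hh0
    obtain hnil | ⟨L0, s0, hL0⟩ := List.eq_nil_or_concat L
    · simp [hnil] at hn
    rw [List.concat_eq_append] at hL0
    have hn0 : L0.length = n := by rw [hL0] at hn; simpa using hn
    have hu : (s.1, !s.2) ≠ s0 := by
      intro hc
      have hred := isReduced_of_toWord hw
      rw [hL0] at hred
      have h2 : FreeGroup.IsReduced [s0, s] := by
        rw [List.append_assoc] at hred; exact List.IsChain.right_of_append hred
      simp only [FreeGroup.IsReduced, List.isChain_cons_cons,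
        List.isChain_singleton, and_true] at h2
      rw [← hc] at h2
      have := h2 rfl
      simp at this
    have hh0b : h0 ∈ ballF r (n+1) := by rw [mem_ballF, hw0, hn]
    have hb1 : ballF r n ⊆ (ballF r (n+1)).erase h0 := by
      intro x hx
      refine Finset.mem_erase.2 ⟨?_, ballF_mono hx⟩
      intro hc; rw [mem_ballF, hc, hw0] at hx; omega
    have hC := step_eq H hb1 (hw0.trans hL0) hn0
      (hstep n _ h0 hb1 (Finset.erase_subset _ _) hh0b) _ hu
    rw [Finset.insert_erase hh0b, ih h0 (by rw [hw0, hn]), ← gen_inv,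
      ← dd_tr H _ _ (gen s), tr_union, tr_tr, inv_mul_cancel, tr_one, hh0,
      inv_mul_cancel_right] at hC
    rw [grow (n+1) h L s (tr ((ballF r (n+1)).erase h0) (gen s) ∪ ballF r (n+1)) hw hn
      Finset.subset_union_right ?_ ?_ ?_, hC]
    · cases hL : L with
      | nil => simp [hL] at hn
      | cons t L1 =>
        rw [← hh0, cost_cons (hw0.trans hL), cost_cons (t := t) (L := L1 ++ [s])]
        rw [hw, hL]; rfl
    · apply Finset.union_subset _ ballF_mono
      intro x hx
      rw [mem_tr] at hx
      have hx := Finset.mem_of_mem_erase hx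
      rw [mem_ballF] at hx ⊢
      have := FreeGroup.norm_mul_le (x * (gen s)⁻¹) (gen s)
      simp only [FreeGroup.norm, inv_mul_cancel_right, toWord_gen] at this
      simp at this; omega
    · simp only [Finset.mem_union, mem_tr, mem_ballF, ← hh0]
      rintro (hc | hc)
      · simp at hc
      · omega
    · intro x hx
      apply Finset.mem_union_left
      obtain ⟨h1, h2⟩ := Finset.mem_erase.1 hx
      rw [mem_tr] at h2 ⊢
      refine Finset.mem_erase.2 ⟨?_, h2⟩
      intro hc; exact h1 (mul_right_cancel (hc.trans hh0))

lemma lower (H : Adm hh) (he : ∀ n, FQ hh (ballF r n) = FQ hh (ballF r 0)) (n : ℕ) :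
    hh {1} + ∑ g ∈ (ballF r n).erase 1, cost hh g ≤ hh (ballF r n) := by
  induction n with
  | zero => simp [ballF_zero]
  | succ n ih =>
    have key : ∀ D : Finset (FG r), D ⊆ ballF r (n+1) → Disjoint D (ballF r n) →
        hh (ballF r n) + ∑ g ∈ D, cost hh g ≤ hh (ballF r n ∪ D) := by
      intro D
      induction D using Finset.induction_on with
      | empty => intro _ _; simp
      | insert h D hD ihD =>
        intro h1 h2
        rw [Finset.disjoint_insert_left] at h2
        have ihD := ihD ((Finset.subset_insert _ _).trans h1) h2.2
        have h3 : h.toWord.length ≤ n + 1 := mem_ballF.1 (h1 (by simp))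
        have h4 : ¬ h.toWord.length ≤ n := fun hc => h2.1 (mem_ballF.2 hc)
        have h5 := leaf_cost H he n h (by omega)
        have h6 := H.anti h (ballF r n ∪ D) ((ballF r (n+1)).erase h)
          ⟨1, Finset.mem_union_left _ (by simp [mem_ballF])⟩ ?_
        · rw [Finset.sum_insert hD, Finset.union_insert]
          rw [h5, dd] at h6
          linarith
        · intro x hx
          refine Finset.mem_erase.2 ⟨?_, ?_⟩
          · rintro rfl
            rcases Finset.mem_union.1 hx with hx | hx
            · exact h2.1 hx
            · exact hD hx
          · rcases Finset.mem_union.1 hx with hx | hx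
            · exact ballF_mono hx
            · exact h1 (Finset.mem_insert_of_mem hx)
    have h1 := key (ballF r (n+1) \ ballF r n) Finset.sdiff_subset Finset.sdiff_disjoint
    rw [Finset.union_sdiff_of_subset ballF_mono] at h1
    have h2 : (ballF r (n+1)).erase 1 = (ballF r n).erase 1 ∪ (ballF r (n+1) \ ballF r n) := by
      ext x
      simp only [Finset.mem_erase, Finset.mem_union, Finset.mem_sdiff]
      constructor
      · rintro ⟨a, b⟩; by_cases hx : x ∈ ballF r n
        · exact Or.inl ⟨a, hx⟩
        · exact Or.inr ⟨b, hx⟩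
      · rintro (⟨a, b⟩ | ⟨a, b⟩)
        · exact ⟨a, ballF_mono b⟩
        · refine ⟨?_, a⟩
          rintro rfl; exact b (by simp [mem_ballF])
    rw [h2, Finset.sum_union]
    · linarith
    · exact (Finset.sdiff_disjoint.symm).mono_left (Finset.erase_subset _ _)

theorem comb_backward (H : Adm hh) (he : ∀ n, FQ hh (ballF r n) = FQ hh (ballF r 0))
    (s : Fin r × Bool) (A : Finset (FG r)) (h1A : (1 : FG r) ∈ A)
    (hA : ∀ f ∈ A, ¬ [s] <:+ f.toWord) : dd hh (gen s) A = dd hh (gen s) {1} := by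
  obtain ⟨n, hn⟩ : ∃ n, A ⊆ ballF r (n+1) := by
    refine ⟨A.sup fun g => g.toWord.length, fun g hg => mem_ballF.2 ?_⟩
    have := Finset.le_sup (f := fun g : FG r => g.toWord.length) hg
    exact this.trans (Nat.le_succ _)
  set P := (ballF r (n+1)).filter (fun f => ¬ [s] <:+ f.toWord) with hP
  have hAP : A ⊆ P := fun f hf => Finset.mem_filter.2 ⟨hn hf, hA f hf⟩
  have h1P : (1 : FG r) ∈ P := hAP h1A
  have hball : SufClosed (ballF r (n+1)) := by
    intro g hg t L hw
    rw [mem_ballF] at hg ⊢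
    rw [(mul_left_tail hw).1]; rw [hw] at hg; simp at hg; omega
  have hPc : SufClosed P := by
    intro g hg t L hw
    obtain ⟨h1, h2⟩ := Finset.mem_filter.1 hg
    refine Finset.mem_filter.2 ⟨hball g h1 t L hw, ?_⟩
    rw [(mul_left_tail hw).1]
    intro hc; apply h2; rw [hw]; exact hc.trans (List.suffix_cons _ _)
  have hsP : gen s ∉ P := by
    intro hc; exact (Finset.mem_filter.1 hc).2 (by rw [toWord_gen])
  have hsc : cost hh (gen s) = dd hh (gen s) {1} := cost_cons (toWord_gen s)
  have hsb : gen s ∈ ballF r (n+1) := by rw [mem_ballF, toWord_gen]; simp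
  have hP'c : SufClosed (insert (gen s) P) := by
    intro g hg t L hw
    rcases Finset.mem_insert.1 hg with rfl | hg
    · rw [toWord_gen] at hw
      injection hw with _ h2
      rw [← h2, ← FreeGroup.one_eq_mk]; exact Finset.mem_insert_of_mem h1P
    · exact Finset.mem_insert_of_mem (hPc g hg t L hw)
  have hPb : P ⊆ ballF r (n+1) := Finset.filter_subset _ _
  have hP'b : insert (gen s) P ⊆ ballF r (n+1) := Finset.insert_subset hsb hPb
  have u1 := upper H {1} (by
    intro g hg t L hw
    rw [Finset.mem_singleton.1 hg] at hw; simp at hw) (by simp) _ P rfl (by simpa using h1P) hPc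
  have u2 := upper H (insert (gen s) P) hP'c (Finset.mem_insert_of_mem h1P) _ (ballF r (n+1)) rfl
    hP'b hball
  have l := lower H he (n+1)
  have hsum : ∑ g ∈ (ballF r (n+1)).erase 1, cost hh g = ∑ g ∈ P \ {1}, cost hh g +
      (cost hh (gen s) + ∑ g ∈ ballF r (n+1) \ insert (gen s) P, cost hh g) := by
    have e1 : (ballF r (n+1)).erase 1 = (P \ {1}) ∪ (ballF r (n+1) \ P) := by
      ext x
      simp only [Finset.mem_erase, Finset.mem_union, Finset.mem_sdiff, Finset.mem_singleton]
      constructor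
      · rintro ⟨a, b⟩; by_cases hx : x ∈ P
        · exact Or.inl ⟨hx, a⟩
        · exact Or.inr ⟨b, hx⟩
      · rintro (⟨a, b⟩ | ⟨a, b⟩)
        · exact ⟨b, hPb a⟩
        · exact ⟨fun hc => b (hc ▸ h1P), a⟩
    rw [e1, Finset.sum_union]
    · congr 1
      rw [← Finset.add_sum_erase (ballF r (n+1) \ P) _ (Finset.mem_sdiff.2 ⟨hsb, hsP⟩)]
      congr 2
      ext x; simp only [Finset.mem_erase, Finset.mem_sdiff, Finset.mem_insert]; tauto
    · exact (Finset.disjoint_sdiff).mono_left Finset.sdiff_subset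
  have a1 := H.anti (gen s) {1} A (by simp) (by simpa using h1A)
  have a2 := H.anti (gen s) A P ⟨1, h1A⟩ hAP
  have a3 : dd hh (gen s) P = hh (insert (gen s) P) - hh P := rfl
  linarith

end Comb

/-! Entropy of countable labelled partitions -/

section Ent

variable {X : Type*} [MeasurableSpace X] {μ : Measure X} {ι K M N : Type*}

/-- measurable fibres -/
def MF (p : X → K) : Prop := ∀ k, MeasurableSet (p ⁻¹' {k})

lemma MF.preimage [Countable K] {p : X → K} (h : MF p) (U : Set K) : MeasurableSet (p ⁻¹' U) := by
  rw [← Set.biUnion_preimage_singleton]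
  exact MeasurableSet.biUnion (Set.to_countable U) fun k _ => h k

lemma MF.comp [Countable K] {p : X → K} (h : MF p) (f : K → M) : MF (fun x => f (p x)) := by
  intro m
  exact h.preimage (f ⁻¹' {m})

lemma MF.lintegral [Countable K] {p : X → K} (h : MF p) (g : K → ℝ≥0∞) :
    ∫⁻ x, g (p x) ∂μ = ∑' k, g k * μ (p ⁻¹' {k}) := by
  let _ : MeasurableSpace K := ⊤
  have hp : Measurable p := fun U _ => h.preimage U
  rw [← lintegral_map (f := g) (fun U _ => trivial) hp, lintegral_countable']
  refine tsum_congr fun k => ?_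
  rw [Measure.map_apply hp trivial]

variable [IsProbabilityMeasure μ]

lemma Hpart_lint [Countable ι] {W : X → ι} (h : MF W) (f : ι → M) [Countable M] :
    Hpart μ (fun x => f (W x)) =
      ∫⁻ x, ENNReal.ofReal (- Real.log (μ.real ((fun y => f (W y)) ⁻¹' {f (W x)}))) ∂μ := by
  rw [(h.comp f).lintegral (μ := μ)
    (fun m => ENNReal.ofReal (- Real.log (μ.real ((fun y => f (W y)) ⁻¹' {m}))))]
  refine tsum_congr fun k => ?_
  rw [← ENNReal.ofReal_toReal (measure_ne_top μ ((fun y => f (W y)) ⁻¹' {k})),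
    ← ENNReal.ofReal_mul']
  · congr 1
    rw [ENNReal.ofReal_toReal (measure_ne_top _ _)]
    rw [Real.negMulLog, Measure.real]; ring
  · exact ENNReal.toReal_nonneg

lemma Hpart_congr [Countable K] [Countable M] {p : X → K} {q : X → M} (hp : MF p) (hq : MF q)
    (h : ∀ x y, p x = p y ↔ q x = q y) : Hpart μ p = Hpart μ q := by
  have e1 := Hpart_lint (μ := μ) hp id
  have e2 := Hpart_lint (μ := μ) hq id
  simp only [id] at e1 e2
  rw [e1, e2]
  refine lintegral_congr fun x => ?_
  congr 4
  ext y
  exact h y x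

lemma nlog_nonneg (s : Set X) : 0 ≤ - Real.log (μ.real s) := by
  have := Real.log_nonpos (measureReal_nonneg (μ := μ) (s := s)) measureReal_le_one
  linarith

lemma Hpart_tsum [Countable ι] {W : X → ι} (h : MF W) (f : ι → M) [Countable M] :
    Hpart μ (fun x => f (W x)) =
      ∑' i, ENNReal.ofReal (μ.real (W ⁻¹' {i}) * - Real.log (μ.real ((fun y => f (W y)) ⁻¹' {f i}))) := by
  rw [Hpart_lint h f, h.lintegral (μ := μ)
    (fun i => ENNReal.ofReal (- Real.log (μ.real ((fun y => f (W y)) ⁻¹' {f i}))))]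
  refine tsum_congr fun i => ?_
  rw [ENNReal.ofReal_mul measureReal_nonneg, mul_comm, ofReal_measureReal]

lemma hasSum_of_tsum_ofReal {u : ι → ℝ} (h0 : ∀ i, 0 ≤ u i)
    (h : ∑' i, ENNReal.ofReal (u i) ≠ ⊤) : HasSum u (∑' i, ENNReal.ofReal (u i)).toReal := by
  have := ENNReal.hasSum_toReal h
  simpa [ENNReal.toReal_ofReal (h0 _), ENNReal.tsum_toReal_eq] using this

lemma Hpart_hasSum [Countable ι] {W : X → ι} (h : MF W) (f : ι → M) [Countable M]
    (hf : Hpart μ (fun x => f (W x)) < ⊤) :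
    HasSum (fun i => μ.real (W ⁻¹' {i}) * - Real.log (μ.real ((fun y => f (W y)) ⁻¹' {f i})))
      (Hpart μ (fun x => f (W x))).toReal := by
  rw [Hpart_tsum h f] at hf ⊢
  exact hasSum_of_tsum_ofReal (fun i => mul_nonneg measureReal_nonneg (nlog_nonneg _)) hf.ne

lemma law_hasSum [Countable ι] {W : X → ι} (h : MF W) : HasSum (fun i => μ.real (W ⁻¹' {i})) 1 := by
  have h1 : ∑' i, ENNReal.ofReal (μ.real (W ⁻¹' {i})) = 1 := by
    have := h.lintegral (μ := μ) (fun _ => 1)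
    simp at this
    rw [this]
    refine tsum_congr fun i => ?_
    rw [Measure.real, ENNReal.ofReal_toReal (measure_ne_top _ _)]
  have := hasSum_of_tsum_ofReal (u := fun i => μ.real (W ⁻¹' {i}))
    (fun i => measureReal_nonneg) (by rw [h1]; simp)
  rwa [h1] at this

/-- elementary inequality with equality case -/
lemma gibbs {p q : ℝ} (hp : 0 < p) (hq : 0 < q) :
    0 ≤ p * (Real.log p - Real.log q) - p + q ∧
    (p * (Real.log p - Real.log q) - p + q = 0 ↔ p = q) := by
  have e : p * (Real.log p - Real.log q) - p + q = p * (q / p - 1 - Real.log (q / p)) := by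
    rw [Real.log_div hq.ne' hp.ne']; field_simp; ring
  have h := Real.log_le_sub_one_of_pos (div_pos hq hp)
  refine ⟨by rw [e]; exact mul_nonneg hp.le (by linarith), ?_⟩
  constructor
  · intro h0
    rw [e] at h0
    by_contra hne
    have h2 := Real.log_lt_sub_one_of_pos (div_pos hq hp)
      (by rw [Ne, div_eq_one_iff_eq hp.ne']; exact fun h => hne h.symm)
    have : 0 < p * (q / p - 1 - Real.log (q / p)) := mul_pos hp (by linarith)
    linarith
  · rintro rfl; simp

lemma pair_sum_fst [Countable K] [Countable M] {x : X → K} {z : X → M} (hx : MF x) (hz : MF z)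
    (s : Set X) (hs : MeasurableSet s) : ∑' k, μ (x ⁻¹' {k} ∩ s) = μ s := by
  have := hx.lintegral (μ := μ.restrict s) (fun _ => 1)
  simp at this
  rw [this]
  exact tsum_congr fun k => by rw [Measure.restrict_apply (hx k)]

lemma pair_fib {x : X → K} {z : X → M} (k : K) (a : M) :
    (fun w => (x w, z w)) ⁻¹' {(k, a)} = x ⁻¹' {k} ∩ z ⁻¹' {a} := by
  ext w; simp

lemma MF.pair {x : X → K} {z : X → M} (hx : MF x) (hz : MF z) : MF (fun w => (x w, z w)) := by
  rintro ⟨k, a⟩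
  rw [pair_fib]; exact (hx k).inter (hz a)

/-- the conditionally independent comparison law -/
def qq (μ : Measure X) (x : X → K) (z : X → M) (f : M → N) (i : K × M) : ℝ :=
  μ.real (x ⁻¹' {i.1} ∩ (fun w => f (z w)) ⁻¹' {f i.2}) / μ.real ((fun w => f (z w)) ⁻¹' {f i.2})
    * μ.real (z ⁻¹' {i.2})

lemma qq_sum [Countable K] [Countable M] [Countable N] {x : X → K} {z : X → M} (f : M → N)
    (hx : MF x) (hz : MF z) : ∃ S ≤ (1:ℝ), HasSum (qq μ x z f) S := by
  have h0 : ∀ i, 0 ≤ qq μ x z f i := fun i => by unfold qq; positivity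
  have h1 : ∑' i, ENNReal.ofReal (qq μ x z f i) ≤ 1 := by
    have e : ∀ i, ENNReal.ofReal (qq μ x z f i) ≤
        μ (x ⁻¹' {i.1} ∩ (fun w => f (z w)) ⁻¹' {f i.2}) *
        ((μ ((fun w => f (z w)) ⁻¹' {f i.2}))⁻¹ * μ (z ⁻¹' {i.2})) := by
      intro i
      unfold qq
      by_cases hb : μ ((fun w => f (z w)) ⁻¹' {f i.2}) = 0
      · simp [Measure.real, hb]
      rw [ENNReal.ofReal_mul (by positivity), ENNReal.ofReal_div_of_pos]
      · simp only [Measure.real, ENNReal.ofReal_toReal (measure_ne_top μ _)]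
        rw [div_eq_mul_inv, mul_assoc]
      · exact ENNReal.toReal_pos hb (measure_ne_top _ _)
    calc _ ≤ ∑' i : K × M, _ := ENNReal.tsum_le_tsum e
      _ = ∑' (a : M) (k : K), μ (x ⁻¹' {k} ∩ (fun w => f (z w)) ⁻¹' {f a}) *
        ((μ ((fun w => f (z w)) ⁻¹' {f a}))⁻¹ * μ (z ⁻¹' {a})) := by
          rw [ENNReal.tsum_prod', ENNReal.tsum_comm]
      _ ≤ ∑' a : M, μ (z ⁻¹' {a}) := by
          refine ENNReal.tsum_le_tsum fun a => ?_
          rw [ENNReal.tsum_mul_right, pair_sum_fst hx hz _ (hz.comp f _), ← mul_assoc,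
            ← div_eq_mul_inv]
          exact (mul_le_mul_left (ENNReal.div_self_le_one) _).trans (by rw [one_mul])
      _ = 1 := by
          have := pair_sum_fst (μ := μ) hz hx Set.univ MeasurableSet.univ
          simpa using this
  exact ⟨_, ENNReal.toReal_le_of_le_ofReal zero_le_one (by simpa using h1),
    hasSum_of_tsum_ofReal h0 (ne_top_of_le_ne_top ENNReal.one_ne_top h1)⟩

/-- Submodularity with equality case. -/
lemma submod [Countable K] [Countable M] [Countable N] {x : X → K} {z : X → M} (f : M → N)
    (hx : MF x) (hz : MF z)
    (h1 : Hpart μ (fun w => (x w, z w)) < ⊤) (h2 : Hpart μ (fun w => f (z w)) < ⊤)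
    (h3 : Hpart μ (fun w => (x w, f (z w))) < ⊤) (h4 : Hpart μ z < ⊤) :
    ((Hpart μ (fun w => (x w, z w))).toReal - (Hpart μ z).toReal ≤
      (Hpart μ (fun w => (x w, f (z w)))).toReal - (Hpart μ (fun w => f (z w))).toReal) ∧
    ((Hpart μ (fun w => (x w, z w))).toReal - (Hpart μ z).toReal =
      (Hpart μ (fun w => (x w, f (z w)))).toReal - (Hpart μ (fun w => f (z w))).toReal ↔
     ∀ k a, μ.real (x ⁻¹' {k} ∩ z ⁻¹' {a}) = qq μ x z f (k, a)) := by
  have hW := hx.pair hz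
  have s1 := Hpart_hasSum hW id h1
  have s2 := Hpart_hasSum hW (fun i => f i.2) h2
  have s3 := Hpart_hasSum hW (fun i => (i.1, f i.2)) h3
  have s4 := Hpart_hasSum hW (fun i => i.2) h4
  have s5 := law_hasSum (μ := μ) hW
  obtain ⟨S, hS1, s6⟩ := qq_sum (μ := μ) f hx hz
  have sd := ((((s3.sub s2).sub s1).add s4).sub s5).add s6
  simp only [id] at sd
  set D := fun i : K × M => _ with hD
  change HasSum D _ at sd
  have key : ∀ i, 0 ≤ D i ∧ (D i = 0 ↔ μ.real (x ⁻¹' {i.1} ∩ z ⁻¹' {i.2}) = qq μ x z f i) := by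
    rintro ⟨k, a⟩
    simp only [hD, pair_fib]
    set p := μ.real (x ⁻¹' {k} ∩ z ⁻¹' {a}) with hp
    have hp0 : 0 ≤ p := measureReal_nonneg
    have hq0 : 0 ≤ qq μ x z f (k, a) := by unfold qq; positivity
    rcases hp0.eq_or_lt with hp0 | hp0
    · rw [← hp0]; simp only [zero_mul, sub_zero, add_zero, zero_add]
      exact ⟨hq0, eq_comm⟩
    have ha : 0 < μ.real (z ⁻¹' {a}) :=
      hp0.trans_le (measureReal_mono Set.inter_subset_right)
    have hkb : 0 < μ.real (x ⁻¹' {k} ∩ (fun w => f (z w)) ⁻¹' {f a}) := by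
      refine hp0.trans_le (measureReal_mono (Set.inter_subset_inter_right _ ?_))
      intro w hw; simp at hw ⊢; rw [hw]
    have hb : 0 < μ.real ((fun w => f (z w)) ⁻¹' {f a}) :=
      hkb.trans_le (measureReal_mono Set.inter_subset_right)
    have hq : 0 < qq μ x z f (k, a) := by unfold qq; positivity
    have hl : Real.log (qq μ x z f (k, a)) =
      Real.log (μ.real (x ⁻¹' {k} ∩ (fun w => f (z w)) ⁻¹' {f a}))
       - Real.log (μ.real ((fun w => f (z w)) ⁻¹' {f a})) + Real.log (μ.real (z ⁻¹' {a})) := by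
      unfold qq
      rw [Real.log_mul (by positivity) (by positivity), Real.log_div (by positivity) (by positivity)]
    have g := gibbs hp0 hq
    rw [hl] at g
    convert g using 3 <;> ring
  have t0 := HasSum.nonneg (fun i => (key i).1) sd
  refine ⟨?_, ?_⟩
  · linarith
  constructor
  · intro he k a
    have : (HasSum D 0) := by
      convert sd using 1
      linarith
    exact ((key (k, a)).2).1 (congrFun ((hasSum_zero_iff_of_nonneg fun i => (key i).1).1 this) (k, a))
  · intro he
    have hD0 : D = fun _ => 0 := funext fun i => ((key i).2).2 (he i.1 i.2)
    have hS : S = 1 := by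
      refine s6.unique ?_
      convert s5 using 1
      ext i; rw [← he]; rw [pair_fib]
    rw [hD0] at sd
    have := sd.unique hasSum_zero
    linarith

lemma Hpart_pair_lt [Countable K] [Countable M] {x : X → K} {z : X → M}
    (hx : MF x) (hz : MF z) (h1 : Hpart μ x < ⊤) (h2 : Hpart μ z < ⊤) :
    Hpart μ (fun w => (x w, z w)) < ⊤ := by
  have hW := hx.pair hz
  have e0 := Hpart_tsum (μ := μ) hW id
  have e1 := Hpart_tsum (μ := μ) hW (fun i => i.1)
  have e2 := Hpart_tsum (μ := μ) hW (fun i => i.2)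
  simp only [id] at e0 e1 e2
  obtain ⟨S, hS1, s6⟩ := qq_sum (μ := μ) (fun _ : M => ()) hx hz
  have e3 : ∑' i, ENNReal.ofReal (qq μ x z (fun _ : M => ()) i) < ⊤ := by
    have h0 : ∀ i, 0 ≤ qq μ x z (fun _ : M => ()) i := fun i => by unfold qq; positivity
    rw [← ENNReal.ofReal_tsum_of_nonneg h0 s6.summable]
    exact ENNReal.ofReal_lt_top
  have : Hpart μ (fun w => (x w, z w)) ≤ Hpart μ x + Hpart μ z +
      ∑' i, ENNReal.ofReal (qq μ x z (fun _ : M => ()) i) := by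
    rw [e0]
    change _ ≤ Hpart μ (fun w => x w) + Hpart μ (fun w => z w) + _
    rw [e1, e2, ← ENNReal.tsum_add, ← ENNReal.tsum_add]
    refine ENNReal.tsum_le_tsum ?_
    rintro ⟨k, a⟩
    have hq0 : 0 ≤ qq μ x z (fun _ : M => ()) (k, a) := by unfold qq; positivity
    rw [← ENNReal.ofReal_add (mul_nonneg measureReal_nonneg (nlog_nonneg _))
        (mul_nonneg measureReal_nonneg (nlog_nonneg _)),
      ← ENNReal.ofReal_add (add_nonneg (mul_nonneg measureReal_nonneg (nlog_nonneg _))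
        (mul_nonneg measureReal_nonneg (nlog_nonneg _))) hq0]
    refine ENNReal.ofReal_le_ofReal ?_
    simp only [pair_fib]
    have hqe : qq μ x z (fun _ : M => ()) (k, a) = μ.real (x ⁻¹' {k}) * μ.real (z ⁻¹' {a}) := by
      simp [qq]
    set p := μ.real (x ⁻¹' {k} ∩ z ⁻¹' {a}) with hp
    have hp0 : 0 ≤ p := measureReal_nonneg
    rcases hp0.eq_or_lt with hp0 | hp0
    · rw [← hp0]; simpa using hq0
    have ha : 0 < μ.real (z ⁻¹' {a}) :=
      hp0.trans_le (measureReal_mono Set.inter_subset_right)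
    have hk : 0 < μ.real (x ⁻¹' {k}) :=
      hp0.trans_le (measureReal_mono Set.inter_subset_left)
    have g := (gibbs hp0 (mul_pos hk ha)).1
    rw [Real.log_mul hk.ne' ha.ne', ← hqe] at g
    change p * -Real.log p ≤ p * -Real.log (μ.real (x ⁻¹' {k})) + p * -Real.log (μ.real (z ⁻¹' {a})) + _
    nlinarith
  exact this.trans_lt (ENNReal.add_lt_top.2 ⟨ENNReal.add_lt_top.2 ⟨h1, h2⟩, e3⟩)

lemma Hpart_comp_mp {p : X → K} (hp : MF p) {S : X → X} (hS : MeasurePreserving S μ μ) :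
    Hpart μ (fun x => p (S x)) = Hpart μ p := by
  refine tsum_congr fun k => ?_
  rw [← hS.measure_preimage (hp k).nullMeasurableSet]; rfl

end Ent

/-! Entropy of the joins over finite sets -/

section Proc

variable {X : Type*} {r : ℕ}

lemma forall_tr (A : Finset (FG r)) (g : FG r) (P : FG r → Prop) :
    (∀ q ∈ tr A g, P q) ↔ ∀ q ∈ A, P (q * g) := by
  unfold tr; exact Finset.forall_mem_image

lemma powS_eq_iff (T : FG r → X → X) (α : X → ℕ) (Q : Set (FG r)) (x y : X) :
    powS T α Q x = powS T α Q y ↔ ∀ q ∈ Q, α (T q x) = α (T q y) := by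
  constructor
  · intro h q hq; exact congrFun h ⟨q, hq⟩
  · intro h; funext q; exact h q q.2

variable [MeasurableSpace X]

lemma MF_powS' {T : FG r → X → X} {α : X → ℕ} {Q : Set (FG r)} [Finite Q]
    (h : ∀ q ∈ Q, MF (pull T q α)) : MF (powS T α Q) := by
  intro k
  have : powS T α Q ⁻¹' {k} = ⋂ q : Q, (pull T q α) ⁻¹' {k q} := by
    ext x; simp [powS, pull, funext_iff]
  rw [this]
  exact MeasurableSet.iInter fun q => h q q.2 _

variable {μ : Measure X} [IsProbabilityMeasure μ] {T : FG r → X → X} {α : X → ℕ}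

/-- real entropy of the join over a finite set -/
def hS (μ : Measure X) (T : FG r → X → X) (α : X → ℕ) (A : Finset (FG r)) : ℝ :=
  (Hpart μ (powS T α (A : Set (FG r)))).toReal


lemma MF_pull
    (hTmp : ∀ g : FG r, MeasurePreserving (T g) μ μ) (hαm : Measurable α) (g : FG r) : MF (pull T g α) := fun k =>
  (hαm.comp (hTmp g).measurable) (measurableSet_singleton k)

lemma MF_powS
    (hTmp : ∀ g : FG r, MeasurePreserving (T g) μ μ) (hαm : Measurable α) (Q : Set (FG r)) [Finite Q] : MF (powS T α Q) :=
  MF_powS' fun q _ => MF_pull hTmp hαm q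

lemma Hpart_insert
    (hTmp : ∀ g : FG r, MeasurePreserving (T g) μ μ) (hαm : Measurable α) (h : FG r) (A : Finset (FG r)) :
    Hpart μ (powS T α ((insert h A : Finset (FG r)) : Set (FG r))) =
    Hpart μ (fun w => (pull T h α w, powS T α (A : Set (FG r)) w)) := by
  refine Hpart_congr (MF_powS hTmp hαm _) ((MF_pull hTmp hαm h).pair (MF_powS hTmp hαm _)) ?_
  intro x y
  rw [Prod.mk.injEq, powS_eq_iff, powS_eq_iff]
  simp [pull]


lemma Hpart_lt
    (hTmp : ∀ g : FG r, MeasurePreserving (T g) μ μ) (hαm : Measurable α) (hHα : Hpart μ α < ⊤) (A : Finset (FG r)) : Hpart μ (powS T α (A : Set (FG r))) < ⊤ := by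
  induction A using Finset.induction_on with
  | empty =>
    rw [Hpart_congr (q := fun _ => ()) (MF_powS hTmp hαm _) (fun k => by simp)]
    · simp [Hpart]
    · intro x y; rw [powS_eq_iff]; simp
  | insert h A _ ih =>
    rw [Hpart_insert hTmp hαm]
    refine Hpart_pair_lt (MF_pull hTmp hαm h) (MF_powS hTmp hαm _) ?_ ih
    have : Hpart μ (fun x => α (T h x)) = Hpart μ α :=
      Hpart_comp_mp (fun k => hαm (measurableSet_singleton k)) (hTmp h)
    exact this.trans_lt hHα

lemma dd_sub {N : Type*} [Countable N]
    (hTmp : ∀ g : FG r, MeasurePreserving (T g) μ μ) (hαm : Measurable α) (hHα : Hpart μ α < ⊤) (h : FG r) (A B : Finset (FG r))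
    (f : (↥(B : Set (FG r)) → ℕ) → N)
    (hf : ∀ x y, f (powS T α (B : Set (FG r)) x) = f (powS T α (B : Set (FG r)) y) ↔
      powS T α (A : Set (FG r)) x = powS T α (A : Set (FG r)) y) :
    dd (hS μ T α) h B ≤ dd (hS μ T α) h A ∧
    (dd (hS μ T α) h B = dd (hS μ T α) h A ↔ ∀ k a,
      μ.real (pull T h α ⁻¹' {k} ∩ powS T α (B : Set (FG r)) ⁻¹' {a}) =
        qq μ (pull T h α) (powS T α (B : Set (FG r))) f (k, a)) := by
  have mB := MF_powS hTmp hαm (B : Set (FG r))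
  have mA := MF_powS hTmp hαm (A : Set (FG r))
  have mh := MF_pull hTmp hαm h
  have e1 : Hpart μ (fun w => f (powS T α (B : Set (FG r)) w)) =
      Hpart μ (powS T α (A : Set (FG r))) := Hpart_congr (mB.comp f) mA hf
  have e2 : Hpart μ (fun w => (pull T h α w, f (powS T α (B : Set (FG r)) w))) =
      Hpart μ (powS T α ((insert h A : Finset (FG r)) : Set (FG r))) := by
    rw [Hpart_insert hTmp hαm]
    refine Hpart_congr (mh.pair (mB.comp f)) (mh.pair mA) ?_
    intro x y
    rw [Prod.mk.injEq, Prod.mk.injEq, hf]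
  have := submod (μ := μ) f mh mB
    (by rw [← Hpart_insert hTmp hαm]; exact Hpart_lt hTmp hαm hHα _)
    (by rw [e1]; exact Hpart_lt hTmp hαm hHα _)
    (by rw [e2]; exact Hpart_lt hTmp hαm hHα _) (Hpart_lt hTmp hαm hHα _)
  rw [e1, e2, ← Hpart_insert hTmp hαm] at this
  exact this


lemma adm
    (hTmul : ∀ g h : FG r, T (g * h) = T g ∘ T h)
    (hTmp : ∀ g : FG r, MeasurePreserving (T g) μ μ) (hαm : Measurable α) (hHα : Hpart μ α < ⊤) : Adm (hS μ T α) where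
  inv A g := by
    unfold hS
    rw [← Hpart_comp_mp (MF_powS hTmp hαm (A : Set (FG r))) (hTmp g)]
    congr 1
    refine Hpart_congr (MF_powS hTmp hαm _) ?_ ?_
    · intro k
      exact (hTmp g).measurable (MF_powS hTmp hαm (A : Set (FG r)) k)
    · intro x y
      rw [powS_eq_iff, powS_eq_iff]
      simp only [Finset.mem_coe, forall_tr, hTmul, Function.comp]
  anti h A B _ hAB := by
    refine (dd_sub hTmp hαm hHα h A B
      (fun v (q : (A : Set (FG r))) => v ⟨q, hAB q.2⟩) ?_).1
    intro x y; exact Iff.rfl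


lemma FF_pow
    (hTmul : ∀ g h : FG r, T (g * h) = T g ∘ T h)
    (hTmp : ∀ g : FG r, MeasurePreserving (T g) μ μ) (hαm : Measurable α) (n : ℕ) : FF T μ (pow T α n) = FQ (hS μ T α) (ballF r n) := by
  have : Finite (ball r n) := (ball_finite r n)
  have hc : ((ballF r n : Finset (FG r)) : Set (FG r)) = ball r n := by
    simp [ballF]
  have mp : MF (pow T α n) := MF_powS hTmp hαm (ball r n)
  unfold FF FQ hS
  rw [hc]
  congr 1
  refine Finset.sum_congr rfl fun i _ => ?_
  congr 1
  refine Hpart_congr (MF.pair mp fun k => (hTmp _).measurable (mp k)) (MF_powS hTmp hαm _) ?_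
  intro x y
  unfold pjoin
  rw [Prod.mk.injEq, powS_eq_iff]
  simp only [pow, pull]
  rw [powS_eq_iff, powS_eq_iff, ← hc]
  simp only [Finset.mem_coe, Finset.mem_union, or_imp, forall_and, forall_tr, hTmul,
    Function.comp]


lemma FF_zero
    (hT1 : T 1 = id)
    (hTmul : ∀ g h : FG r, T (g * h) = T g ∘ T h)
    (hTmp : ∀ g : FG r, MeasurePreserving (T g) μ μ) (hαm : Measurable α) : FF T μ α = FQ (hS μ T α) (ballF r 0) := by
  have mα : MF α := fun k => hαm (measurableSet_singleton k)
  have h0 : ∀ x y, α x = α y ↔ powS T α ((ballF r 0 : Finset (FG r)) : Set (FG r)) x =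
      powS T α ((ballF r 0 : Finset (FG r)) : Set (FG r)) y := by
    intro x y
    rw [powS_eq_iff, ballF_zero]; simp [hT1]
  rw [← FF_pow hTmul hTmp hαm]
  have : Finite (ball r 0) := (ball_finite r 0)
  have hc : ((ballF r 0 : Finset (FG r)) : Set (FG r)) = ball r 0 := by
    simp [ballF]
  rw [hc] at h0
  have mp : MF (pow T α 0) := MF_powS hTmp hαm (ball r 0)
  unfold FF
  congr 1
  · rw [Hpart_congr mα mp h0]
  · refine Finset.sum_congr rfl fun i _ => ?_
    congr 1
    refine Hpart_congr (MF.pair mα (MF_pull hTmp hαm _))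
      (MF.pair mp fun k => (hTmp _).measurable (mp k)) ?_
    intro x y
    unfold pjoin pull
    rw [Prod.mk.injEq, Prod.mk.injEq, h0, h0]; rfl

end Proc

/-! Pasts -/

lemma past_of_not_suffix {r : ℕ} {h f : FG r} {t : Fin r × Bool} {L : List (Fin r × Bool)}
    (hw : h.toWord = t :: L) (hf : ¬ h.toWord <:+ f.toWord) : f ∈ Past h (FreeGroup.mk L) := by
  intro l
  induction l generalizing f with
  | nil => intro h; exact absurd rfl h
  | cons a l ih =>
    intro _ h1 h2 h3
    simp at h1; subst h1
    cases l with
    | nil => simp at h2; subst h2; exact absurd (List.suffix_refl _) hf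
    | cons b l =>
      have h3' : List.IsChain adjL (a :: b :: l) := h3
      rw [List.isChain_cons_cons] at h3'
      obtain ⟨⟨_, ⟨u, rfl⟩, hb⟩, h4⟩ := h3'
      by_cases hsb : h.toWord <:+ b.toWord
      · rcases mul_left_cases u a with hc | hc
        · rw [hb, hc, List.suffix_cons_iff] at hsb
          rcases hsb with hsb | hsb
          · have : a.toWord = L := by rw [hw] at hsb; simp at hsb; exact hsb.2.symm
            rw [← this, FreeGroup.mk_toWord]; simp
          · exact absurd hsb hf
        · rw [← hb] at hc
          refine absurd ?_ hf
          rw [hc]; exact hsb.trans (List.suffix_cons _ _)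
      · refine List.mem_cons_of_mem _ (ih hsb (by simp) (by simp) ?_ h4)
        rw [List.getLast?_cons_cons] at h2; exact h2

lemma path_exists {r : ℕ} (g : FG r) (s : Fin r × Bool) (Y : List (Fin r × Bool)) :
    ∀ e : FG r, e.toWord = Y ++ [s] → ∃ l : List (FG r), l ≠ [] ∧ l.head? = some (e * g) ∧
      l.getLast? = some (gen s * g) ∧ l.IsChain adjL ∧ g ∉ l := by
  induction Y with
  | nil =>
    intro e he
    have : e = gen s := by
      rw [← FreeGroup.toWord_inj, he, toWord_gen]; rfl
    subst this
    refine ⟨[gen s * g], by simp, by simp, by simp, by simp, ?_⟩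
    simp only [List.mem_singleton]
    intro hc
    have : gen s = 1 := by simpa using hc.symm
    rw [this] at he; simp at he
  | cons t Y ih =>
    intro e he
    obtain ⟨h1, h2⟩ := mul_left_tail he
    obtain ⟨l, l1, l2, l3, l4, l5⟩ := ih _ h1
    cases l with
    | nil => exact absurd rfl l1
    | cons a l =>
      simp at l2
      refine ⟨e * g :: a :: l, by simp, by simp, ?_, ?_, ?_⟩
      · rw [List.getLast?_cons_cons]; exact l3
      · rw [List.isChain_cons_cons]
        refine ⟨⟨(gen t)⁻¹, ?_, ?_⟩, l4⟩
        · rw [gen_inv]; exact ⟨_, rfl⟩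
        · rw [l2]; conv_rhs => rw [h2]
          rw [mul_assoc, inv_mul_cancel_left]; rfl
      · rw [List.mem_cons, not_or]
        refine ⟨fun hc => ?_, l5⟩
        have : e = 1 := by simpa using hc.symm
        rw [this] at he; simp at he

lemma not_suffix_of_past {r : ℕ} {g f : FG r} {s : Fin r × Bool} (hf : f ∈ Past (gen s * g) g) :
    ¬ [s] <:+ (f * g⁻¹).toWord := by
  rintro ⟨Y, hY⟩
  obtain ⟨l, l1, l2, l3, l4, l5⟩ := path_exists g s Y _ hY.symm
  rw [inv_mul_cancel_right] at l2
  exact l5 (hf l l1 l2 l3 l4)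

lemma self_mem_past {r : ℕ} (h g : FG r) : g ∈ Past h g := by
  intro l _ h2 _ _
  exact List.mem_of_head? h2

/-! Conditional expectations -/

section Cond

variable {X : Type*} [mX : MeasurableSpace X] {μ : Measure X} [IsProbabilityMeasure μ]

lemma sAlg_le {mX : MeasurableSpace X} {K : Type*} [Countable K] {p : X → K} (hp : MF p) :
    sAlg p ≤ mX := by
  rintro _ ⟨U, _, rfl⟩
  exact hp.preimage U

lemma int_ind {B S : Set X} (hB : MeasurableSet B) :
    ∫ x in S, B.indicator (fun _ => (1:ℝ)) x ∂μ = μ.real (B ∩ S) := by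
  rw [integral_indicator_const _ hB]
  simp [measureReal_restrict_apply hB]

lemma int_const {S : Set X} (hS : MeasurableSet S) {W : X → ℝ} {c : ℝ} (h : ∀ x ∈ S, W x = c) :
    ∫ x in S, W x ∂μ = c * μ.real S := by
  rw [setIntegral_congr_fun (g := fun _ => c) hS h]
  simp [mul_comm]

lemma integrable_ind {B : Set X} (hB : MeasurableSet B) :
    Integrable (B.indicator (fun _ => (1:ℝ))) μ := (integrable_const _).indicator hB

lemma condW {y : X → ℕ} (hy : MF y) {B : Set X} (hB : MeasurableSet B) :
    ∃ w : ℕ → ℝ, (∀ x, (μ[B.indicator (fun _ => (1:ℝ)) | sAlg y]) x = w (y x)) ∧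
      ∀ j, w j * μ.real (y ⁻¹' {j}) = μ.real (B ∩ y ⁻¹' {j}) := by
  have hle := sAlg_le hy
  have hm : StronglyMeasurable[sAlg y] (μ[B.indicator (fun _ => (1:ℝ)) | sAlg y]) :=
    stronglyMeasurable_condExp
  have hfac : Function.FactorsThrough (μ[B.indicator (fun _ => (1:ℝ)) | sAlg y]) y := by
    intro a b hab
    obtain ⟨U, -, hU⟩ := hm.measurable
      (measurableSet_singleton ((μ[B.indicator (fun _ => (1:ℝ)) | sAlg y]) b))
    have hb : b ∈ y ⁻¹' U := by rw [hU]; rfl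
    have ha : a ∈ y ⁻¹' U := by
      rw [Set.mem_preimage, hab]; exact hb
    rw [hU] at ha
    exact ha
  refine ⟨Function.extend y (μ[B.indicator (fun _ => (1:ℝ)) | sAlg y]) 0,
    fun x => (hfac.extend_apply _ x).symm, fun j => ?_⟩
  rw [← int_ind hB, ← setIntegral_condExp hle (integrable_ind hB)
    (show MeasurableSet[sAlg y] (y ⁻¹' {j}) from ⟨{j}, trivial, rfl⟩)]
  refine (int_const (hy j) ?_).symm
  intro x hx
  have : y x = j := hx
  rw [← this]; exact (hfac.extend_apply _ x).symm

variable {r : ℕ} {T : FG r → X → X} {α : X → ℕ}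

/-- cylinder sets over finite subsets of `P` -/
def cyl (T : FG r → X → X) (α : X → ℕ) (P : Set (FG r)) : Set (Set X) :=
  {S | ∃ A : Finset (FG r), (A : Set (FG r)) ⊆ P ∧
    ∃ U : Set (↥(A : Set (FG r)) → ℕ), S = powS T α (A : Set (FG r)) ⁻¹' U}

lemma pull_MF_sAlgSet (P : Set (FG r)) {q : FG r} (hq : q ∈ P) :
    @MF X (sAlgSet T α P) _ (pull T q α) := by
  intro k
  have h : sAlg (pull T q α) ≤ sAlgSet T α P := by
    unfold sAlgSet
    exact le_iSup₂_of_le q hq le_rfl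
  exact h _ ⟨{k}, trivial, rfl⟩

lemma powS_meas_sAlgSet (P : Set (FG r)) {A : Finset (FG r)} (hA : (A : Set (FG r)) ⊆ P)
    (U : Set (↥(A : Set (FG r)) → ℕ)) :
    MeasurableSet[sAlgSet T α P] (powS T α (A : Set (FG r)) ⁻¹' U) := by
  have : @MF X (sAlgSet T α P) _ (powS T α (A : Set (FG r))) :=
    @MF_powS' X r (sAlgSet T α P) T α _ _ fun q hq => pull_MF_sAlgSet P (hA hq)
  exact @MF.preimage X (sAlgSet T α P) _ _ _ this U

lemma sAlgSet_eq (P : Set (FG r)) :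
    sAlgSet T α P = MeasurableSpace.generateFrom (cyl T α P) := by
  apply le_antisymm
  · unfold sAlgSet
    refine iSup₂_le fun q hq => ?_
    rintro _ ⟨U, _, rfl⟩
    refine MeasurableSpace.measurableSet_generateFrom
      ⟨{q}, by simpa using hq, {v | v ⟨q, by simp⟩ ∈ U}, rfl⟩
  · refine MeasurableSpace.generateFrom_le ?_
    rintro _ ⟨A, hA, U, rfl⟩
    exact powS_meas_sAlgSet P hA U

lemma cyl_pi (P : Set (FG r)) : IsPiSystem (cyl T α P) := by
  rintro _ ⟨A, hA, U, rfl⟩ _ ⟨B, hB, V, rfl⟩ _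
  refine ⟨A ∪ B, by simp [hA, hB],
    {v | (fun q : ↥(A : Set (FG r)) => v ⟨q, by
      have := q.2; simp only [Finset.mem_coe] at this; simp [this]⟩) ∈ U ∧
      (fun q : ↥(B : Set (FG r)) => v ⟨q, by
      have := q.2; simp only [Finset.mem_coe] at this; simp [this]⟩) ∈ V}, rfl⟩

lemma sAlgSet_le (hm : ∀ q, MF (pull T q α)) (P : Set (FG r)) : sAlgSet T α P ≤ mX := by
  unfold sAlgSet
  exact iSup₂_le fun q _ => sAlg_le (hm q)

/-- The Markov property at `(h, g)` is conditional independence of atoms. -/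
lemma markov_fwd (hm : ∀ q, MF (pull T q α)) {h g : FG r} {k : ℕ} {P : Set (FG r)}
    (hM : (μ[((pull T h α) ⁻¹' {k}).indicator (fun _ => (1:ℝ)) | sAlgSet T α P])
      =ᵐ[μ] (μ[((pull T h α) ⁻¹' {k}).indicator (fun _ => (1:ℝ)) | sAlg (pull T g α)]))
    (A : Finset (FG r)) (hA : (A : Set (FG r)) ⊆ P) (hg : g ∈ A)
    (a : ↥(A : Set (FG r)) → ℕ) :
    μ.real (pull T h α ⁻¹' {k} ∩ powS T α (A : Set (FG r)) ⁻¹' {a}) =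
        qq μ (pull T h α) (powS T α (A : Set (FG r)))
          (fun v => v ⟨g, Finset.mem_coe.2 hg⟩) (k, a) := by
  set B := pull T h α ⁻¹' {k} with hBd
  have hB : MeasurableSet B := hm h k
  obtain ⟨w, hw1, hw2⟩ := condW (μ := μ) (hm g) hB
  have mz : MF (powS T α (A : Set (FG r))) := MF_powS' fun q _ => hm q
  have e1 := setIntegral_condExp (μ := μ) (sAlgSet_le hm P) (integrable_ind hB)
    (powS_meas_sAlgSet P hA {a})
  rw [setIntegral_congr_ae (g := (μ[B.indicator (fun _ => (1:ℝ)) | sAlg (pull T g α)])) (mz a)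
    (hM.mono fun x hx _ => hx), int_ind hB,
    int_const (c := w (a ⟨g, Finset.mem_coe.2 hg⟩)) (mz a)] at e1
  · rw [← e1]
    unfold qq
    have hsub : powS T α (A : Set (FG r)) ⁻¹' {a} ⊆
        pull T g α ⁻¹' {a ⟨g, Finset.mem_coe.2 hg⟩} := by
      intro x hx
      have hx : powS T α (A : Set (FG r)) x = a := hx
      rw [← hx]; rfl
    change _ = μ.real (B ∩ pull T g α ⁻¹' {a ⟨g, Finset.mem_coe.2 hg⟩}) /
      μ.real (pull T g α ⁻¹' {a ⟨g, Finset.mem_coe.2 hg⟩}) * _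
    rw [← hw2]
    by_cases h0 : μ.real (pull T g α ⁻¹' {a ⟨g, Finset.mem_coe.2 hg⟩}) = 0
    · have : μ.real (powS T α (A : Set (FG r)) ⁻¹' {a}) = 0 :=
        le_antisymm ((measureReal_mono hsub).trans h0.le) measureReal_nonneg
      simp [this]
    · rw [mul_div_cancel_right₀ _ h0]
  · intro x hx
    have hx : powS T α (A : Set (FG r)) x = a := hx
    rw [hw1, ← hx]; rfl

lemma markov_bwd (hm : ∀ q, MF (pull T q α)) {h g : FG r} {k : ℕ} {P : Set (FG r)} (hgP : g ∈ P)
    (hM : ∀ (A : Finset (FG r)), (A : Set (FG r)) ⊆ P → ∀ hg : g ∈ A,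
     ∀ (a : ↥(A : Set (FG r)) → ℕ),
    μ.real (pull T h α ⁻¹' {k} ∩ powS T α (A : Set (FG r)) ⁻¹' {a}) =
        qq μ (pull T h α) (powS T α (A : Set (FG r)))
          (fun v => v ⟨g, Finset.mem_coe.2 hg⟩) (k, a)) :
    (μ[((pull T h α) ⁻¹' {k}).indicator (fun _ => (1:ℝ)) | sAlgSet T α P])
      =ᵐ[μ] (μ[((pull T h α) ⁻¹' {k}).indicator (fun _ => (1:ℝ)) | sAlg (pull T g α)]) := by
  set B := pull T h α ⁻¹' {k} with hBd
  have hB : MeasurableSet B := hm h k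
  have hle := sAlgSet_le hm P
  have hgle : sAlg (pull T g α) ≤ sAlgSet T α P := by
    unfold sAlgSet
    exact le_iSup₂_of_le g hgP le_rfl
  obtain ⟨w, hw1, hw2⟩ := condW (μ := μ) (hm g) hB
  set W := μ[B.indicator (fun _ => (1:ℝ)) | sAlg (pull T g α)] with hW
  have iW : Integrable W μ := integrable_condExp
  have iB := integrable_ind (μ := μ) hB
  -- atoms
  have hatom : ∀ (A : Finset (FG r)), (A : Set (FG r)) ⊆ P → ∀ hg : g ∈ A,
      ∀ (a : ↥(A : Set (FG r)) → ℕ), ∫ x in powS T α (A : Set (FG r)) ⁻¹' {a}, W x ∂μ =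
        ∫ x in powS T α (A : Set (FG r)) ⁻¹' {a}, B.indicator (fun _ => (1:ℝ)) x ∂μ := by
    intro A hA hg a
    have mz : MF (powS T α (A : Set (FG r))) := MF_powS' fun q _ => hm q
    rw [int_ind hB, hM A hA hg a, int_const (c := w (a ⟨g, Finset.mem_coe.2 hg⟩)) (mz a)]
    · unfold qq
      have hsub : powS T α (A : Set (FG r)) ⁻¹' {a} ⊆
          pull T g α ⁻¹' {a ⟨g, Finset.mem_coe.2 hg⟩} := by
        intro x hx
        have hx : powS T α (A : Set (FG r)) x = a := hx
        rw [← hx]; rfl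
      change _ = μ.real (B ∩ pull T g α ⁻¹' {a ⟨g, Finset.mem_coe.2 hg⟩}) /
        μ.real (pull T g α ⁻¹' {a ⟨g, Finset.mem_coe.2 hg⟩}) * _
      rw [← hw2]
      by_cases h0 : μ.real (pull T g α ⁻¹' {a ⟨g, Finset.mem_coe.2 hg⟩}) = 0
      · have : μ.real (powS T α (A : Set (FG r)) ⁻¹' {a}) = 0 :=
          le_antisymm ((measureReal_mono hsub).trans h0.le) measureReal_nonneg
        simp [this]
      · rw [mul_div_cancel_right₀ _ h0]
    · intro x hx
      have hx : powS T α (A : Set (FG r)) x = a := hx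
      rw [hw1, ← hx]; rfl
  -- cylinder sets containing the coordinate `g`
  have hcyl : ∀ (A : Finset (FG r)), (A : Set (FG r)) ⊆ P → g ∈ A →
      ∀ U : Set (↥(A : Set (FG r)) → ℕ), ∫ x in powS T α (A : Set (FG r)) ⁻¹' U, W x ∂μ =
        ∫ x in powS T α (A : Set (FG r)) ⁻¹' U, B.indicator (fun _ => (1:ℝ)) x ∂μ := by
    intro A hA hg U
    have mz : MF (powS T α (A : Set (FG r))) := MF_powS' fun q _ => hm q
    have hU : powS T α (A : Set (FG r)) ⁻¹' U =
        ⋃ a : U, powS T α (A : Set (FG r)) ⁻¹' {a.1} := by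
      ext x; simp
    have hdis : Pairwise (Function.onFun Disjoint
        fun a : U => powS T α (A : Set (FG r)) ⁻¹' {a.1}) := by
      intro a b hab
      refine Disjoint.preimage _ ?_
      rw [Set.disjoint_singleton]
      exact fun hc => hab (Subtype.ext hc)
    rw [hU, integral_iUnion (fun a => mz _) hdis iW.integrableOn,
      integral_iUnion (fun a => mz _) hdis iB.integrableOn]
    exact tsum_congr fun a => hatom A hA hg a
  have hall : ∀ S, MeasurableSet[sAlgSet T α P] S →
      ∫ x in S, W x ∂μ = ∫ x in S, B.indicator (fun _ => (1:ℝ)) x ∂μ := by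
    have huniv : ∫ x, W x ∂μ = ∫ x, B.indicator (fun _ => (1:ℝ)) x ∂μ :=
      integral_condExp (sAlg_le (hm g))
    refine MeasurableSpace.induction_on_inter (sAlgSet_eq P) (cyl_pi P) ?_ ?_ ?_ ?_
    · simp
    · rintro _ ⟨A, hA, U, rfl⟩
      have := hcyl (insert g A) (by
        intro q hq
        rw [Finset.mem_coe, Finset.mem_insert] at hq
        rcases hq with rfl | hq
        · exact hgP
        · exact hA hq) (Finset.mem_insert_self _ _)
        {v | (fun q : ↥(A : Set (FG r)) => v ⟨q, by
          have := q.2; simp only [Finset.mem_coe] at this; simp [this]⟩) ∈ U}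
      exact this
    · intro S hS hI
      have e1 := integral_add_compl (hle _ hS) iW
      have e2 := integral_add_compl (hle _ hS) iB
      linarith
    · intro f hd hf hI
      rw [integral_iUnion (fun i => hle _ (hf i)) hd iW.integrableOn,
        integral_iUnion (fun i => hle _ (hf i)) hd iB.integrableOn]
      exact tsum_congr hI
  refine (ae_eq_condExp_of_forall_setIntegral_eq hle iB (fun S _ _ => iW.integrableOn)
    (fun S hS _ => hall S hS) ?_).symm
  exact (stronglyMeasurable_condExp.mono hgle).aestronglyMeasurable

end Cond

section Final

variable {X : Type*} [MeasurableSpace X] {r : ℕ} {μ : Measure X} [IsProbabilityMeasure μ]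
    {T : FG r → X → X} {α : X → ℕ}

lemma dd_iff (hTmp : ∀ g : FG r, MeasurePreserving (T g) μ μ)
    (hαm : Measurable α) (hHα : Hpart μ α < ⊤) (h g : FG r) (A : Finset (FG r)) (hg : g ∈ A) :
    dd (hS μ T α) h A = dd (hS μ T α) h {g} ↔ ∀ k a,
      μ.real (pull T h α ⁻¹' {k} ∩ powS T α (A : Set (FG r)) ⁻¹' {a}) =
        qq μ (pull T h α) (powS T α (A : Set (FG r)))
          (fun v => v ⟨g, Finset.mem_coe.2 hg⟩) (k, a) := by
  refine (dd_sub hTmp hαm hHα h {g} A _ ?_).2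
  intro x y
  rw [powS_eq_iff]
  simp [powS]

theorem markov_iff (hTmul : ∀ g h : FG r, T (g * h) = T g ∘ T h)
    (hTmp : ∀ g : FG r, MeasurePreserving (T g) μ μ)
    (hαm : Measurable α) (hHα : Hpart μ α < ⊤) :
    IsMarkov μ T α ↔ ∀ n, FQ (hS μ T α) (ballF r n) = FQ (hS μ T α) (ballF r 0) := by
  have H := adm (μ := μ) hTmul hTmp hαm hHα
  have hm := fun q => MF_pull (μ := μ) hTmp hαm q
  constructor
  · intro hM
    refine comb_forward H ?_
    intro t L h A hw hA hf
    rw [dd_iff hTmp hαm hHα h _ A hA]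
    intro k
    refine markov_fwd hm (P := Past h (FreeGroup.mk L)) ?_ A ?_ hA
    · have := hM (gen t) ⟨t, rfl⟩ (FreeGroup.mk L) k
      rw [← (mul_left_tail hw).2] at this
      exact this
    · intro f hfA
      exact past_of_not_suffix hw (hf f hfA)
  · rintro he _ ⟨s, rfl⟩ g k
    refine markov_bwd hm (self_mem_past _ _) ?_
    intro A hA hg
    refine (dd_iff hTmp hαm hHα (gen s * g) g A hg).1 ?_ k
    have h1 := comb_backward H he s (tr A g⁻¹) (by
      rw [mem_tr]; simpa using hg) (by
      intro f hf
      rw [mem_tr, inv_inv] at hf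
      have := not_suffix_of_past (hA hf)
      rwa [mul_inv_cancel_right] at this)
    rw [← dd_tr H (gen s) (tr A g⁻¹) g, ← dd_tr H (gen s) {1} g, tr_tr] at h1
    simpa [tr] using h1

end Final

/-- a finite-entropy `G`-process is Markov if and only if
`F(T,α) = f(T,α)`. -/
theorem stmt_17 {r : ℕ} (hr : 1 ≤ r) {X : Type*} [MeasurableSpace X] [StandardBorelSpace X]
    (μ : Measure X) [IsProbabilityMeasure μ]
    (T : FG r → X → X) (hT1 : T 1 = id)
    (hTmul : ∀ g h : FG r, T (g * h) = T g ∘ T h)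
    (hTmp : ∀ g : FG r, MeasurePreserving (T g) μ μ)
    (α : X → ℕ) (hαm : Measurable α) (hHα : Hpart μ α < ⊤) :
    IsMarkov μ T α ↔ littleF T μ α = ((FF T μ α : ℝ) : EReal) := by
  rw [markov_iff hTmul hTmp hαm hHα, FF_zero hT1 hTmul hTmp hαm]
  have H := adm (μ := μ) hTmul hTmp hαm hHα
  unfold littleF
  simp only [FF_pow hTmul hTmp hαm]
  constructor
  · intro h
    simp only [h]
    exact ciInf_const
  · intro h n
    cases n with
    | zero => rfl
    | succ n =>
      refine le_antisymm (FQ_ball_le H _) ?_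
      have h2 := iInf_le (fun n : ℕ => ((FQ (hS μ T α) (ballF r (n + 1)) : ℝ) : EReal)) n
      rw [h] at h2
      exact_mod_cast h2

end

end Bowen
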